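/- Let d and n satisfy (d ≥ 5 and n ≥ 9) or (d ≥ 6 and n ≥ 7). For generic f ∈ S^d and generic linear form x ∈ S^1, every R_f^d-module morphism h : R_f^{d-1} → R_f^d/xR_f^{d-1} is induced by multiplication by a linear form: there exists y ∈ S^1 such that h(B) = class of yB for all B ∈ R_f^{d-1}. Here h is called an R_f^d-module morphism if there exists a linear map h' : R_f^{2d-1} → R_f^{2d}/xR_f^{2d-1} such that h'(AB) = A·h(B) in R_f^{2d}/xR_f^{2d-1} for all A ∈ R_f^d and B ∈ R_f^{d-1}. -/

import Mathlib

open MvPolynomial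

noncomputable section

abbrev S (n : ℕ) : Type := MvPolynomial (Fin (n + 1)) ℂ

/-- The Jacobian ideal of `f`, generated by its partial derivatives. -/
def jacobianIdeal {n : ℕ} (f : S n) : Ideal (S n) :=
  Ideal.span (Set.range fun i => MvPolynomial.pderiv i f)

/-- The degree-`k` graded piece of `S/I`: the image of the homogeneous degree-`k`
polynomials in the quotient. -/
def quotPiece {n : ℕ} (I : Ideal (S n)) (k : ℕ) : Submodule ℂ (S n ⧸ I) :=
  (MvPolynomial.homogeneousSubmodule (Fin (n + 1)) ℂ k).map
    (Ideal.Quotient.mkₐ ℂ I).toLinearMap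

/-- The degree-`k` graded piece `R_f^k` of the Jacobian ring `R_f = S/J_f`. -/
def Rpiece {n : ℕ} (f : S n) (k : ℕ) : Submodule ℂ (S n ⧸ jacobianIdeal f) :=
  quotPiece (jacobianIdeal f) k

/-- `f` defines a smooth hypersurface: its partial derivatives have no common
zero in `ℂ^{n+1} \ {0}`. -/
def SmoothHyp {n : ℕ} (f : S n) : Prop :=
  ∀ v : Fin (n + 1) → ℂ, (∀ i, MvPolynomial.eval v (MvPolynomial.pderiv i f) = 0) → v = 0

/-- A polynomial function on a complex vector space: an element of the algebra of
functions generated by the linear functionals. -/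
def IsPolyFun {M : Type} [AddCommGroup M] [Module ℂ M] (φ : M → ℂ) : Prop :=
  φ ∈ Algebra.adjoin ℂ {ψ : M → ℂ | ∃ l : M →ₗ[ℂ] ℂ, ψ = ⇑l}

/-- A property `P` holds for generic points of `M`: it holds on a nonempty
Zariski-open subset, i.e. on the nonvanishing locus of some polynomial function
that is not identically zero. -/
def GenericallyHolds {M : Type} [AddCommGroup M] [Module ℂ M] (P : M → Prop) : Prop :=
  ∃ φ : M → ℂ, IsPolyFun φ ∧ (∃ x, φ x ≠ 0) ∧ ∀ x, φ x ≠ 0 → P x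

/-- Substitution of the linear change of coordinates given by the matrix `A`. -/
def substLin {n : ℕ} (A : Matrix (Fin (n + 1)) (Fin (n + 1)) ℂ) (f : S n) : S n :=
  MvPolynomial.aeval (fun i => ∑ j, A i j • MvPolynomial.X j) f

/-- A regular sequence: each `f i` is a nonzerodivisor modulo the previous ones. -/
def IsRegularSeq {n c : ℕ} (f : Fin c → S n) : Prop :=
  ∀ (i : Fin c) (g : S n),
    f i * g ∈ Ideal.span (f '' {j | j < i}) → g ∈ Ideal.span (f '' {j | j < i})

/-- Zariski-closed subset of a complex vector space: common zero locus of a set of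
polynomial functions. -/
def IsZariskiClosed {M : Type} [AddCommGroup M] [Module ℂ M] (T : Set M) : Prop :=
  ∃ 𝒮 : Set (M → ℂ), (∀ φ ∈ 𝒮, IsPolyFun φ) ∧ T = {x | ∀ φ ∈ 𝒮, φ x = 0}

/-- An irreducible Zariski-closed subset. -/
def IsIrredClosed {M : Type} [AddCommGroup M] [Module ℂ M] (Z : Set M) : Prop :=
  IsZariskiClosed Z ∧ Z.Nonempty ∧
    ∀ C₁ C₂ : Set M, IsZariskiClosed C₁ → IsZariskiClosed C₂ →
      Z ⊆ C₁ ∪ C₂ → Z ⊆ C₁ ∨ Z ⊆ C₂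

/-- The (Krull) dimension of the algebraic set `T` is at least `m`: there is a strictly
increasing chain of `m+1` irreducible closed subsets contained in `T`. -/
def algDimGE {M : Type} [AddCommGroup M] [Module ℂ M] (T : Set M) (m : ℕ) : Prop :=
  ∃ Z : Fin (m + 1) → Set M, StrictMono Z ∧ (∀ i, IsIrredClosed (Z i)) ∧
    Z (Fin.last m) ⊆ T


/-- The ideal `J_f + (x)` of `S`; the degree-`k` piece of `S/(J_f + (x))` is
`R_f^k / x·R_f^{k-1}`. -/
def JX {n : ℕ} (f x : S n) : Ideal (S n) :=
  jacobianIdeal f ⊔ Ideal.span {x}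

section Lefschetz

variable {σ : Type*} [Fintype σ]

/-- The lowering operator of the `sl₂`-action on `ℂ[x]/(xᵢ^(c+1))`, lifted to polynomials. -/
def lowering (c : ℕ) (p : MvPolynomial σ ℂ) : MvPolynomial σ ℂ :=
  ∑ i, ((c : MvPolynomial σ ℂ) * pderiv i p - X i * pderiv i (pderiv i p))

/-- The ideal generated by the powers `X i ^ a`. -/
def powIdeal (σ : Type*) (a : ℕ) : Ideal (MvPolynomial σ ℂ) :=
  Ideal.span (Set.range fun i => X i ^ a)

lemma lowering_add (c : ℕ) (p q : MvPolynomial σ ℂ) :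
    lowering c (p + q) = lowering c p + lowering c q := by
  simp only [lowering, ← Finset.sum_add_distrib, map_add]
  exact Finset.sum_congr rfl fun i _ => by ring

lemma lowering_mul_X_pow_mem (c : ℕ) (i : σ) (q : MvPolynomial σ ℂ) :
    lowering c (q * X i ^ (c + 1)) ∈ powIdeal σ (c + 1) := by
  classical
  refine Ideal.sum_mem _ fun j _ => ?_
  refine Ideal.mem_of_dvd _ ?_ (Ideal.subset_span ⟨i, rfl⟩ : X i ^ (c + 1) ∈ powIdeal σ (c + 1))
  by_cases h : i = j
  · subst h
    rcases c with _ | c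
    · simp [Derivation.leibniz]
    · refine ⟨(c + 1 : MvPolynomial σ ℂ) * pderiv i q - (2 * (c + 2) : MvPolynomial σ ℂ)
        * pderiv i q - X i * pderiv i (pderiv i q), ?_⟩
      simp [Derivation.leibniz, Derivation.leibniz_pow]
      ring
  · have h1 : pderiv j (X i ^ (c + 1) : MvPolynomial σ ℂ) = 0 := by
      simp [Derivation.leibniz_pow, pderiv_X_of_ne h]
    refine ⟨(c : MvPolynomial σ ℂ) * pderiv j q - X j * pderiv j (pderiv j q), ?_⟩
    simp only [pderiv_mul, h1, map_add, map_zero]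
    simp only [mul_zero, add_zero]
    ring

lemma lowering_mem (c : ℕ) {p : MvPolynomial σ ℂ} (hp : p ∈ powIdeal σ (c + 1)) :
    lowering c p ∈ powIdeal σ (c + 1) := by
  obtain ⟨b, rfl⟩ := Ideal.mem_span_range_iff_exists_fun.1 hp
  have hs : ∀ s : Finset σ, lowering c (∑ i ∈ s, b i * X i ^ (c + 1)) ∈ powIdeal σ (c + 1) := by
    classical
    intro s
    induction s using Finset.induction_on with
    | empty => simp [lowering]
    | insert i s hi ih =>
      rw [Finset.sum_insert hi, lowering_add]
      exact Ideal.add_mem _ (lowering_mul_X_pow_mem c i _) ih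
  exact hs _

lemma isHomogeneous_lowering (c : ℕ) {p : MvPolynomial σ ℂ} {k : ℕ}
    (hp : p.IsHomogeneous (k + 1)) : (lowering c p).IsHomogeneous k := by
  refine IsHomogeneous.sum _ _ _ fun i _ => ?_
  have h1 : (pderiv i p).IsHomogeneous k := hp.pderiv
  refine IsHomogeneous.sub ?_ ?_
  · simpa using (isHomogeneous_C σ (c : ℂ)).mul h1
  · rcases k with _ | k
    · rw [← totalDegree_zero_iff_isHomogeneous, totalDegree_eq_zero_iff_eq_C] at h1
      rw [h1]
      simpa using isHomogeneous_zero _ _ _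
    · have := (isHomogeneous_X ℂ i).mul (h1.pderiv (i := i))
      rwa [Nat.add_sub_cancel, add_comm] at this

lemma lowering_eq_zero (c : ℕ) {p : MvPolynomial σ ℂ} (hp : p.IsHomogeneous 0) :
    lowering c p = 0 := by
  rw [← totalDegree_zero_iff_isHomogeneous, totalDegree_eq_zero_iff_eq_C] at hp
  rw [hp]
  simp [lowering]

lemma lowering_sum_X_mul (c : ℕ) {p : MvPolynomial σ ℂ} {k : ℕ} (hp : p.IsHomogeneous k) :
    lowering c ((∑ i, X i) * p) = (∑ i, X i) * lowering c p
      + ((Fintype.card σ * c : ℕ) - 2 * k : MvPolynomial σ ℂ) * p := by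
  classical
  have hd : ∀ i : σ, pderiv i (∑ j, X j : MvPolynomial σ ℂ) = 1 := by
    intro i
    simp [pderiv_X, Pi.single_apply]
  have he := hp.sum_X_mul_pderiv
  have : ∀ i : σ, (c : MvPolynomial σ ℂ) * pderiv i ((∑ i, X i) * p)
      - X i * pderiv i (pderiv i ((∑ i, X i) * p))
      = (∑ i, X i) * ((c : MvPolynomial σ ℂ) * pderiv i p - X i * pderiv i (pderiv i p))
        + (c : MvPolynomial σ ℂ) * p - (2 : MvPolynomial σ ℂ) * (X i * pderiv i p) := by
    intro i
    simp only [pderiv_mul, hd, map_add, one_mul]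
    ring
  simp only [lowering, this, Finset.sum_sub_distrib, Finset.sum_add_distrib, ← Finset.mul_sum, he]
  simp
  ring

lemma isHomogeneous_sum_X : (∑ i, X i : MvPolynomial σ ℂ).IsHomogeneous 1 :=
  IsHomogeneous.sum _ _ _ fun i _ => isHomogeneous_X ℂ i

lemma lowering_sum_X_pow_mul (c : ℕ) {p : MvPolynomial σ ℂ} {k : ℕ} (hp : p.IsHomogeneous k)
    (s : ℕ) :
    lowering c ((∑ i, X i) ^ (s + 1) * p) = (∑ i, X i) ^ (s + 1) * lowering c p
      + ((s + 1) * ((Fintype.card σ * c : ℕ) - 2 * k - s) : MvPolynomial σ ℂ)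
        * ((∑ i, X i) ^ s * p) := by
  induction s with
  | zero => simpa using lowering_sum_X_mul c hp
  | succ s ih =>
    have h1 : ((∑ i, X i) ^ (s + 1) * p).IsHomogeneous (s + 1 + k) := by
      simpa using (isHomogeneous_sum_X.pow (s + 1)).mul hp
    have h2 : (∑ i, X i) ^ (s + 1 + 1) * p = (∑ i, X i) * ((∑ i, X i) ^ (s + 1) * p) := by ring
    rw [h2, lowering_sum_X_mul c h1, ih]
    push_cast
    ring

/-- Hard Lefschetz for the monomial complete intersection `ℂ[x]/(xᵢ^(c+1))`. -/
theorem mem_powIdeal_of_sum_X_pow_mul_mem (c : ℕ) {k s : ℕ} {p : MvPolynomial σ ℂ}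
    (hp : p.IsHomogeneous k) (hks : 2 * k + s ≤ Fintype.card σ * c)
    (h : (∑ i, X i) ^ s * p ∈ powIdeal σ (c + 1)) : p ∈ powIdeal σ (c + 1) := by
  induction k generalizing s p with
  | zero =>
    induction s with
    | zero => simpa using h
    | succ s ih =>
      refine ih (by omega) ?_
      have h1 := lowering_mem c h
      rw [lowering_sum_X_pow_mul c hp, lowering_eq_zero c hp, mul_zero, zero_add] at h1
      have h2 : ((s + 1) * ((Fintype.card σ * c : ℕ) - 2 * (0 : ℕ) - s) : MvPolynomial σ ℂ)
          = C ((s + 1) * ((Fintype.card σ * c : ℕ) - s) : ℂ) := by simp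
      rw [h2] at h1
      refine (Ideal.unit_mul_mem_iff_mem _ ?_).1 h1
      refine IsUnit.map C (IsUnit.mk0 _ (mul_ne_zero (Nat.cast_add_one_ne_zero s) ?_))
      rw [sub_ne_zero]
      exact_mod_cast (by omega : Fintype.card σ * c ≠ s)
  | succ k ihk =>
    induction s with
    | zero => simpa using h
    | succ s ih =>
      refine ih (by omega) ?_
      have h1 := lowering_mem c h
      rw [lowering_sum_X_pow_mul c hp] at h1
      have h3 : (∑ i, X i) ^ (s + 2) * lowering c p ∈ powIdeal σ (c + 1) := by
        have := Ideal.sub_mem _ (Ideal.mul_mem_left _ (∑ i, X i) h1)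
          (Ideal.mul_mem_left _
            ((s + 1) * ((Fintype.card σ * c : ℕ) - 2 * (k + 1 : ℕ) - s) : MvPolynomial σ ℂ) h)
        convert this using 1
        ring
      have h4 := ihk (isHomogeneous_lowering c hp) (by omega) h3
      have h5 := Ideal.sub_mem _ h1 (Ideal.mul_mem_left _ ((∑ i, X i) ^ (s + 1)) h4)
      rw [add_sub_cancel_left] at h5
      have h2 : ((s + 1) * ((Fintype.card σ * c : ℕ) - 2 * (k + 1 : ℕ) - s) : MvPolynomial σ ℂ)
          = C ((s + 1) * ((Fintype.card σ * c : ℕ) - (2 * (k + 1) + s : ℕ)) : ℂ) := by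
        simp only [map_mul, map_add, map_sub, map_natCast, map_one]
        push_cast
        ring
      rw [h2] at h5
      refine (Ideal.unit_mul_mem_iff_mem _ ?_).1 h5
      refine IsUnit.map C (IsUnit.mk0 _ (mul_ne_zero (Nat.cast_add_one_ne_zero s) ?_))
      rw [sub_ne_zero]
      exact_mod_cast (by omega : Fintype.card σ * c ≠ 2 * (k + 1) + s)

end Lefschetz

section TruncatedCoefficients

variable {τ σ : Type*}

/-- Polynomials all of whose coefficients of exponents bounded by `c` lie in `J`. -/
def truncIdeal (τ : Type*) {R : Type*} [CommRing R] (c : ℕ) (J : Ideal R) :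
    Ideal (MvPolynomial τ R) where
  carrier := {p | ∀ e : τ →₀ ℕ, (∀ i, e i ≤ c) → coeff e p ∈ J}
  add_mem' hp hq e he := by
    rw [coeff_add]
    exact J.add_mem (hp e he) (hq e he)
  zero_mem' e _ := by simp
  smul_mem' q p hp e he := by
    classical
    rw [smul_eq_mul, coeff_mul]
    refine J.sum_mem fun x hx => J.mul_mem_left _ (hp _ fun i => ?_)
    rw [Finset.HasAntidiagonal.mem_antidiagonal] at hx
    refine le_trans ?_ (he i)
    rw [← hx, Finsupp.add_apply]
    exact Nat.le_add_left _ _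

lemma mem_truncIdeal {R : Type*} [CommRing R] {c : ℕ} {J : Ideal R} {p : MvPolynomial τ R} :
    p ∈ truncIdeal τ c J ↔ ∀ e : τ →₀ ℕ, (∀ i, e i ≤ c) → coeff e p ∈ J := Iff.rfl

/-- The ideal generated by the image of `J ⊆ ℂ[σ]` and the powers `X i ^ a`, `i ∈ τ`. -/
def extendIdeal (τ : Type*) (a : ℕ) (J : Ideal (MvPolynomial σ ℂ)) :
    Ideal (MvPolynomial (τ ⊕ σ) ℂ) :=
  J.map (rename Sum.inr : MvPolynomial σ ℂ →ₐ[ℂ] MvPolynomial (τ ⊕ σ) ℂ) ⊔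
    Ideal.span (Set.range fun i : τ => X (Sum.inl i) ^ a)

lemma sumAlgEquiv_rename_inr (p : MvPolynomial σ ℂ) :
    sumAlgEquiv ℂ τ σ (rename Sum.inr p) = C p :=
  DFunLike.congr_fun (sumAlgEquiv_comp_rename_inr ℂ τ σ) p

lemma mem_extendIdeal {c : ℕ} {J : Ideal (MvPolynomial σ ℂ)} {p : MvPolynomial (τ ⊕ σ) ℂ} :
    p ∈ extendIdeal τ (c + 1) J ↔ sumAlgEquiv ℂ τ σ p ∈ truncIdeal τ c J := by
  classical
  constructor
  · intro hp
    have : extendIdeal τ (c + 1) J ≤ (truncIdeal τ c J).comap (sumAlgEquiv ℂ τ σ) := by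
      refine sup_le (Ideal.map_le_iff_le_comap.2 fun q hq => ?_) (Ideal.span_le.2 ?_)
      · simp only [Ideal.mem_comap, sumAlgEquiv_rename_inr, mem_truncIdeal]
        intro e _
        rw [coeff_C]
        split_ifs
        exacts [hq, J.zero_mem]
      · rintro _ ⟨i, rfl⟩
        simp only [SetLike.mem_coe, Ideal.mem_comap, map_pow, sumAlgEquiv_X_inl, mem_truncIdeal]
        intro e he
        rw [coeff_X_pow, if_neg]
        · exact J.zero_mem
        · rintro rfl
          simpa using he i
    exact this hp
  · intro hp
    have key : ∀ q : MvPolynomial τ (MvPolynomial σ ℂ), q ∈ truncIdeal τ c J →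
        (sumAlgEquiv ℂ τ σ).symm q ∈ extendIdeal τ (c + 1) J := by
      intro q hq
      rw [← support_sum_monomial_coeff q, map_sum]
      refine Ideal.sum_mem _ fun e _ => ?_
      have hC : (sumAlgEquiv ℂ τ σ).symm (C (coeff e q)) = rename Sum.inr (coeff e q) := by
        rw [← sumAlgEquiv_rename_inr, AlgEquiv.symm_apply_apply]
      rw [← mul_one (coeff e q), ← C_mul_monomial, map_mul, hC]
      by_cases he : ∀ i, e i ≤ c
      · exact Ideal.mul_mem_right _ _ (Ideal.mem_sup_left (Ideal.mem_map_of_mem _ (hq e he)))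
      · push Not at he
        obtain ⟨i, hi⟩ := he
        refine Ideal.mul_mem_left _ _ (Ideal.mem_sup_right ?_)
        have h1 : (monomial e (1 : MvPolynomial σ ℂ)) =
            monomial (e - Finsupp.single i (c + 1)) 1 * X i ^ (c + 1) := by
          rw [X_pow_eq_monomial, monomial_mul, one_mul, tsub_add_cancel_of_le]
          rwa [Finsupp.single_le_iff]
        rw [h1, map_mul, map_pow, sumAlgEquiv_symm_X]
        exact Ideal.mul_mem_left _ _ (Ideal.subset_span ⟨i, rfl⟩)
    simpa using key _ hp

lemma sumAlgEquiv_monomial (e : τ →₀ ℕ) (e' : σ →₀ ℕ) (r : ℂ) :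
    sumAlgEquiv ℂ τ σ (monomial (Finsupp.sumElim e e') r) = monomial e (monomial e' r) := by
  have h : Finsupp.sumElim e e' = Finsupp.sumFinsuppAddEquivProdFinsupp.symm (e, e') := rfl
  rw [h]
  unfold sumAlgEquiv MvPolynomial
  simp [monomial, AddMonoidAlgebra.domCongr_single]

lemma coeff_coeff_sumAlgEquiv (p : MvPolynomial (τ ⊕ σ) ℂ) (e : τ →₀ ℕ) (e' : σ →₀ ℕ) :
    coeff e' (coeff e (sumAlgEquiv ℂ τ σ p)) = coeff (Finsupp.sumElim e e') p := by
  classical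
  have hinj : ∀ f f', Finsupp.sumElim f f' = Finsupp.sumElim e e' ↔ f = e ∧ f' = e' := by
    intro f f'
    refine (Finsupp.sumFinsuppAddEquivProdFinsupp.symm.injective.eq_iff
      (a := (f, f')) (b := (e, e'))).trans Prod.ext_iff
  induction p using MvPolynomial.induction_on' with
  | add p q hp hq => simp [coeff_add, hp, hq]
  | monomial f r =>
    obtain ⟨⟨f, f'⟩, rfl⟩ := Finsupp.sumFinsuppAddEquivProdFinsupp.symm.surjective f
    change coeff e' (coeff e (sumAlgEquiv ℂ τ σ (monomial (Finsupp.sumElim f f') r))) =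
      coeff (Finsupp.sumElim e e') (monomial (Finsupp.sumElim f f') r)
    rw [sumAlgEquiv_monomial, coeff_monomial, coeff_monomial]
    simp only [hinj, ite_and]
    split_ifs <;> simp_all [coeff_monomial]

lemma weight_one_eq_degree {ι : Type*} (e : ι →₀ ℕ) : Finsupp.weight (1 : ι → ℕ) e = e.degree :=
  (DFunLike.congr_fun Finsupp.degree_eq_weight_one e).symm

lemma degree_sumElim (e : τ →₀ ℕ) (e' : σ →₀ ℕ) :
    (Finsupp.sumElim e e').degree = e.degree + e'.degree := by
  classical
  have : Finsupp.sumElim e e' = e.mapDomain Sum.inl + e'.mapDomain Sum.inr := by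
    ext (i | i)
    · simp [Finsupp.mapDomain_apply Sum.inl_injective, Finsupp.mapDomain_of_notMem_range]
    · simp [Finsupp.mapDomain_apply Sum.inr_injective, Finsupp.mapDomain_of_notMem_range]
  rw [this]
  simp [Finsupp.degree_mapDomain]

lemma isHomogeneous_coeff_sumAlgEquiv {p : MvPolynomial (τ ⊕ σ) ℂ} {D : ℕ}
    (hp : p.IsHomogeneous D) {e : τ →₀ ℕ} {k : ℕ} (hk : e.degree + k = D) :
    (coeff e (sumAlgEquiv ℂ τ σ p)).IsHomogeneous k := by
  intro e' he'
  rw [coeff_coeff_sumAlgEquiv] at he'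
  have h2 := hp he'
  rw [weight_one_eq_degree, degree_sumElim] at h2
  rw [weight_one_eq_degree]
  omega

lemma coeff_sumAlgEquiv_eq_zero {p : MvPolynomial (τ ⊕ σ) ℂ} {D : ℕ}
    (hp : p.IsHomogeneous D) {e : τ →₀ ℕ} (hk : D < e.degree) :
    coeff e (sumAlgEquiv ℂ τ σ p) = 0 := by
  ext e'
  rw [coeff_coeff_sumAlgEquiv, coeff_zero]
  refine hp.coeff_eq_zero ?_
  rw [degree_sumElim]
  omega

lemma powIdeal_sum (a : ℕ) : powIdeal (τ ⊕ σ) a = extendIdeal τ a (powIdeal σ a) := by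
  rw [powIdeal, extendIdeal, powIdeal, Ideal.map_span, ← Set.range_comp, ← Ideal.span_union,
    Set.union_comm, Sum.range_eq]
  simp [Function.comp_def]

end TruncatedCoefficients

section HomogeneousComponents

variable {σ : Type*}

lemma homogeneousComponent_mul_isHomogeneous {F : MvPolynomial σ ℂ} {a : ℕ}
    (hF : F.IsHomogeneous a) (b : MvPolynomial σ ℂ) (k : ℕ) :
    homogeneousComponent (k + a) (b * F) = homogeneousComponent k b * F := by
  induction b using MvPolynomial.induction_on' with
  | add p q hp hq => simp only [add_mul, map_add, hp, hq]
  | monomial e r =>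
    have h1 : (monomial e r : MvPolynomial σ ℂ).IsHomogeneous e.degree :=
      isHomogeneous_monomial _ rfl
    rw [homogeneousComponent_of_mem (h1.mul hF), homogeneousComponent_of_mem h1]
    by_cases h : k = e.degree
    · simp [h]
    · simp [h]

lemma homogeneousComponent_mul_eq_zero {F : MvPolynomial σ ℂ} {a k : ℕ}
    (hF : F.IsHomogeneous a) (b : MvPolynomial σ ℂ) (hk : k < a) :
    homogeneousComponent k (b * F) = 0 := by
  induction b using MvPolynomial.induction_on' with
  | add p q hp hq => simp only [add_mul, map_add, hp, hq, add_zero]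
  | monomial e r =>
    have h1 : (monomial e r : MvPolynomial σ ℂ).IsHomogeneous e.degree :=
      isHomogeneous_monomial _ rfl
    rw [homogeneousComponent_of_mem (h1.mul hF), if_neg]
    omega

variable {ι : Type*} [Fintype ι] {F : ι → MvPolynomial σ ℂ} {a : ℕ}

lemma exists_isHomogeneous_coeff (hF : ∀ l, (F l).IsHomogeneous a) {p : MvPolynomial σ ℂ} {k : ℕ}
    (hp : p.IsHomogeneous (k + a)) (h : p ∈ Ideal.span (Set.range F)) :
    ∃ b : ι → MvPolynomial σ ℂ, (∀ l, (b l).IsHomogeneous k) ∧ p = ∑ l, b l * F l := by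
  obtain ⟨b, rfl⟩ := Ideal.mem_span_range_iff_exists_fun.1 h
  refine ⟨fun l => homogeneousComponent k (b l),
    fun l => homogeneousComponent_isHomogeneous _ _, ?_⟩
  rw [← homogeneousComponent_eq_self hp, map_sum]
  exact Finset.sum_congr rfl fun l _ => homogeneousComponent_mul_isHomogeneous (hF l) _ _

lemma eq_zero_of_mem_span_of_degree_lt (hF : ∀ l, (F l).IsHomogeneous a) {p : MvPolynomial σ ℂ}
    {k : ℕ} (hp : p.IsHomogeneous k) (hk : k < a) (h : p ∈ Ideal.span (Set.range F)) : p = 0 := by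
  obtain ⟨b, rfl⟩ := Ideal.mem_span_range_iff_exists_fun.1 h
  rw [← homogeneousComponent_eq_self hp, map_sum]
  exact Finset.sum_eq_zero fun l _ => homogeneousComponent_mul_eq_zero (hF l) _ hk

lemma homogeneousComponent_mem_span (hF : ∀ l, (F l).IsHomogeneous a) {p : MvPolynomial σ ℂ}
    (k : ℕ) (h : p ∈ Ideal.span (Set.range F)) :
    homogeneousComponent k p ∈ Ideal.span (Set.range F) := by
  obtain ⟨b, rfl⟩ := Ideal.mem_span_range_iff_exists_fun.1 h
  rw [map_sum]
  refine Ideal.sum_mem _ fun l _ => ?_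
  rcases lt_or_ge k a with hk | hk
  · rw [homogeneousComponent_mul_eq_zero (hF l) _ hk]
    exact Ideal.zero_mem _
  · obtain ⟨j, rfl⟩ := Nat.exists_eq_add_of_le' hk
    rw [homogeneousComponent_mul_isHomogeneous (hF l)]
    exact Ideal.mul_mem_left _ _ (Ideal.subset_span ⟨l, rfl⟩)

end HomogeneousComponents

section Koszul

/-- Every syzygy of `F` over the finite set `s` is a combination of Koszul syzygies. -/
def KoszulOn {ι R : Type*} [CommRing R] (F : ι → R) (s : Finset ι) : Prop :=
  ∀ y : ι → R, ∑ l ∈ s, y l * F l = 0 →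
    ∃ c : ι → ι → R, ∀ l ∈ s, y l = ∑ m ∈ s, (c l m - c m l) * F m

lemma KoszulOn.exists_of_insert {ι R : Type*} [CommRing R] [DecidableEq ι] {F : ι → R}
    {s : Finset ι} (hs : KoszulOn F s) {i : ι} (hi : i ∉ s) {y : ι → R}
    (hy : ∑ l ∈ insert i s, y l * F l = 0) (hyi : y i ∈ Ideal.span (F '' s)) :
    ∃ c : ι → ι → R, ∀ l ∈ insert i s, y l = ∑ m ∈ insert i s, (c l m - c m l) * F m := by
  obtain ⟨r, hr⟩ : ∃ r : ι → R, y i = ∑ j ∈ s, r j * F j := by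
    obtain ⟨r, hr⟩ := (Submodule.mem_span_image_finset_iff_exists_fun R).1 hyi
    refine ⟨fun j => if h : j ∈ s then r ⟨j, h⟩ else 0, ?_⟩
    rw [← hr, ← Finset.sum_coe_sort s]
    exact Finset.sum_congr rfl fun j _ => by simp
  rw [Finset.sum_insert hi] at hy
  obtain ⟨c, hc⟩ := hs (fun j => y j + r j * F i) <| by
    rw [← hy, hr, Finset.sum_mul, ← Finset.sum_add_distrib]
    exact Finset.sum_congr rfl fun j _ => by ring
  have hne : ∀ {j}, j ∈ s → j ≠ i := fun hj h => hi (h ▸ hj)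
  refine ⟨fun l m => if l = i then (if m = i then 0 else r m) else if m = i then 0 else c l m,
    fun l hl => ?_⟩
  rw [Finset.sum_insert hi]
  rcases Finset.mem_insert.1 hl with rfl | hl
  · simp only [if_true, sub_self, zero_mul, zero_add, hr]
    refine Finset.sum_congr rfl fun j hj => ?_
    simp [hne hj]
  · have h1 := hc l hl
    simp only [hne hl, if_true, if_false, zero_sub]
    rw [eq_neg_add_iff_add_eq.2 ((add_comm _ _).trans h1), neg_mul]
    congr 1
    refine Finset.sum_congr rfl fun j hj => ?_
    simp [hne hj]

variable {σ : Type*}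

lemma mem_span_X_pow_image (a : ℕ) (s : Set σ) (p : MvPolynomial σ ℂ) :
    p ∈ Ideal.span ((fun i => (X i ^ a : MvPolynomial σ ℂ)) '' s) ↔
      ∀ e ∈ p.support, ∃ i ∈ s, a ≤ e i := by
  have h := mem_ideal_span_monomial_image (x := p) (s := (fun i => Finsupp.single i a) '' s)
  rw [Set.image_image] at h
  simp only [X_pow_eq_monomial]
  rw [h]
  simp

lemma mem_span_of_X_pow_mul_mem {a : ℕ} {s : Set σ} {i : σ} (hi : i ∉ s) {p : MvPolynomial σ ℂ}
    (h : X i ^ a * p ∈ Ideal.span ((fun i => (X i ^ a : MvPolynomial σ ℂ)) '' s)) :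
    p ∈ Ideal.span ((fun i => (X i ^ a : MvPolynomial σ ℂ)) '' s) := by
  classical
  rw [mem_span_X_pow_image] at h ⊢
  intro e he
  obtain ⟨j, hj, hje⟩ := h (Finsupp.single i a + e) <| by
    rw [X_pow_eq_monomial, mem_support_iff, coeff_monomial_mul, one_mul]
    exact mem_support_iff.1 he
  refine ⟨j, hj, ?_⟩
  rwa [Finsupp.add_apply, Finsupp.single_eq_of_ne (by rintro rfl; exact hi hj), zero_add] at hje

lemma koszulOn_X_pow (a : ℕ) (s : Finset σ) :
    KoszulOn (fun i => (X i ^ a : MvPolynomial σ ℂ)) s := by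
  classical
  induction s using Finset.induction_on with
  | empty => exact fun y _ => ⟨0, by simp⟩
  | insert i s hi ih =>
    intro y hy
    refine ih.exists_of_insert hi hy (mem_span_of_X_pow_mul_mem (by simpa using hi) ?_)
    rw [Finset.sum_insert hi, mul_comm, add_eq_zero_iff_eq_neg] at hy
    rw [hy]
    exact neg_mem (Ideal.sum_mem _ fun j hj =>
      Ideal.mul_mem_left _ _ (Ideal.subset_span ⟨j, by simpa using hj, rfl⟩))

/-- The forms `g, X_k ^ a`. -/
def consPow {κ : Type*} (g : MvPolynomial κ ℂ) (a : ℕ) : Option κ → MvPolynomial κ ℂ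
  | none => g
  | some k => X k ^ a

lemma exists_koszul_consPow {κ : Type*} [Fintype κ] {g : MvPolynomial κ ℂ} {a : ℕ}
    {y : Option κ → MvPolynomial κ ℂ} (hy : ∑ l, y l * consPow g a l = 0)
    (hinj : g * y none ∈ powIdeal κ a → y none ∈ powIdeal κ a) :
    ∃ c : Option κ → Option κ → MvPolynomial κ ℂ,
      ∀ l, y l = ∑ m, (c l m - c m l) * consPow g a m := by
  classical
  have h0 : KoszulOn (consPow g a) (Finset.univ.map Function.Embedding.some) := by
    intro y hy
    rw [Finset.sum_map] at hy
    obtain ⟨c, hc⟩ := koszulOn_X_pow a Finset.univ (fun k => y (some k)) hy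
    refine ⟨fun l m => l.elim 0 fun l => m.elim 0 fun m => c l m, ?_⟩
    intro l hl
    obtain ⟨k, -, rfl⟩ := Finset.mem_map.1 hl
    rw [Finset.sum_map]
    exact hc k (Finset.mem_univ _)
  have hspan : consPow g a '' ((Finset.univ.map Function.Embedding.some : Finset (Option κ)) :
      Set (Option κ)) = Set.range fun k => X k ^ a := by
    ext p
    simp [consPow]
  have hins : insert none (Finset.univ.map Function.Embedding.some) =
      (Finset.univ : Finset (Option κ)) := by
    ext l
    cases l <;> simp
  have h1 := h0.exists_of_insert (i := none) (y := y) (by simp) (by rw [hins]; exact hy) <| by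
    rw [hspan]
    refine hinj ?_
    rw [Fintype.sum_option, mul_comm, add_eq_zero_iff_eq_neg] at hy
    change g * y none = _ at hy
    rw [hy]
    exact neg_mem (Ideal.sum_mem _ fun j _ =>
      Ideal.mul_mem_left _ _ (Ideal.subset_span ⟨j, rfl⟩))
  rw [hins] at h1
  simpa using h1

end Koszul

section SpecialForms

variable {τ σ : Type*}

lemma exists_degree_eq_add_le [Fintype τ] {c : ℕ} {e : τ →₀ ℕ} (he : ∀ i, e i ≤ c) :
    ∀ r : ℕ, e.degree + r ≤ Fintype.card τ * c →
      ∃ e' : τ →₀ ℕ, e'.degree = r ∧ ∀ i, (e' + e) i ≤ c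
  | 0, _ => ⟨0, by simp, by simpa using he⟩
  | r + 1, hr => by
    classical
    obtain ⟨e', hr', he'⟩ := exists_degree_eq_add_le he r (by omega)
    obtain ⟨i, hi⟩ : ∃ i, (e' + e) i < c := by
      by_contra! h
      have h1 : Fintype.card τ * c ≤ (e' + e).degree := by
        rw [Finsupp.degree_eq_sum, ← smul_eq_mul, ← Finset.card_univ]
        exact Finset.card_nsmul_le_sum _ _ _ fun i _ => h i
      rw [map_add, hr'] at h1
      omega
    refine ⟨e' + Finsupp.single i 1, by simp [hr'], fun j => ?_⟩
    have hj := he' j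
    rw [Finsupp.add_apply] at hi hj
    rw [Finsupp.add_apply, Finsupp.add_apply, Finsupp.single_apply]
    split_ifs with h
    · subst h
      omega
    · omega

variable [Fintype σ]

/-- The `a`-th power of the sum of the variables indexed by `σ`. -/
def sumPow (τ σ : Type*) [Fintype σ] (a : ℕ) : MvPolynomial (τ ⊕ σ) ℂ :=
  (∑ i : σ, X (Sum.inr i)) ^ a

lemma sumPow_eq_rename (a : ℕ) : sumPow τ σ a = rename Sum.inr ((∑ i : σ, X i) ^ a) := by
  simp [sumPow]

lemma isHomogeneous_sumPow (a : ℕ) : (sumPow τ σ a).IsHomogeneous a := by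
  have h : (∑ i : σ, (X (Sum.inr i) : MvPolynomial (τ ⊕ σ) ℂ)).IsHomogeneous 1 :=
    IsHomogeneous.sum _ _ _ fun i _ => isHomogeneous_X _ _
  simpa [sumPow] using h.pow a

lemma isHomogeneous_consPow {κ : Type*} {g : MvPolynomial κ ℂ} {a : ℕ} (hg : g.IsHomogeneous a)
    (l : Option κ) : (consPow g a l).IsHomogeneous a := by
  cases l
  · exact hg
  · exact isHomogeneous_X_pow _ _

lemma mem_powIdeal_of_sumPow_mul_mem {c D : ℕ} (hu : 2 * D + (c + 1) ≤ Fintype.card σ * c)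
    {p : MvPolynomial (τ ⊕ σ) ℂ} (hp : p.IsHomogeneous D)
    (h : sumPow τ σ (c + 1) * p ∈ powIdeal (τ ⊕ σ) (c + 1)) : p ∈ powIdeal (τ ⊕ σ) (c + 1) := by
  rw [powIdeal_sum, mem_extendIdeal] at h ⊢
  intro e he
  have h1 := h e he
  rw [map_mul, sumPow_eq_rename, sumAlgEquiv_rename_inr, coeff_C_mul] at h1
  rcases lt_or_ge D e.degree with hD | hD
  · rw [coeff_sumAlgEquiv_eq_zero hp hD]
    exact Ideal.zero_mem _
  · exact mem_powIdeal_of_sum_X_pow_mul_mem c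
      (isHomogeneous_coeff_sumAlgEquiv hp (Nat.add_sub_of_le hD)) (by omega) h1

lemma span_consPow {κ : Type*} (g : MvPolynomial κ ℂ) (a : ℕ) :
    Ideal.span (Set.range (consPow g a)) = Ideal.span {g} ⊔ powIdeal κ a := by
  rw [powIdeal, ← Ideal.span_union]
  congr 1
  ext p
  simp [consPow, Option.exists, eq_comm]

lemma span_consPow_sumPow (a : ℕ) :
    Ideal.span (Set.range (consPow (sumPow τ σ a) a)) =
      extendIdeal τ a (Ideal.span (Set.range (consPow ((∑ i : σ, X i) ^ a) a))) := by
  rw [span_consPow, span_consPow, powIdeal_sum, extendIdeal, extendIdeal, ← sup_assoc,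
    Ideal.map_sup, Ideal.map_span, Set.image_singleton, sumPow_eq_rename]

variable [Fintype τ]

theorem mem_span_of_forall_mul_mem_special {c : ℕ}
    (hv : c + 4 ≤ Fintype.card τ * c) [Nonempty σ] {m : MvPolynomial (τ ⊕ σ) ℂ}
    (hm : m.IsHomogeneous (c + 3))
    (h : ∀ Q : MvPolynomial (τ ⊕ σ) ℂ, Q.IsHomogeneous (c + 1) →
      Q * m ∈ Ideal.span (Set.range (consPow (sumPow τ σ (c + 1)) (c + 1)))) :
    m ∈ Ideal.span (Set.range (consPow (sumPow τ σ (c + 1)) (c + 1))) := by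
  simp only [span_consPow_sumPow, mem_extendIdeal] at h ⊢
  intro e he
  rcases lt_or_ge (c + 3) e.degree with hD | hD
  · rw [coeff_sumAlgEquiv_eq_zero hm hD]
    exact Ideal.zero_mem _
  have key : ∀ (e' : τ →₀ ℕ) (f : σ →₀ ℕ), e'.degree + f.degree = c + 1 →
      (∀ i, (e' + e) i ≤ c) → monomial f 1 * coeff e (sumAlgEquiv ℂ τ σ m) ∈
        Ideal.span (Set.range (consPow ((∑ i : σ, X i) ^ (c + 1)) (c + 1))) := by
    intro e' f hef he'
    have h1 := h (monomial (Finsupp.sumElim e' f) 1)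
      (isHomogeneous_monomial _ (by rw [degree_sumElim, hef])) _ he'
    rwa [map_mul, sumAlgEquiv_monomial, coeff_monomial_mul] at h1
  rcases le_or_gt e.degree 2 with h2 | h2
  · obtain ⟨e', hd, he'⟩ := exists_degree_eq_add_le he (c + 1) (by omega)
    simpa using key e' 0 (by simp [hd]) he'
  · obtain ⟨e', hd, he'⟩ := exists_degree_eq_add_le he (c + 4 - e.degree) (by omega)
    obtain ⟨s⟩ := ‹Nonempty σ›
    have h3 := key e' (Finsupp.single s (e.degree - 3)) (by rw [hd, Finsupp.degree_single]; omega) he'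
    have h4 : (coeff e (sumAlgEquiv ℂ τ σ m)).IsHomogeneous (c + 3 - e.degree) :=
      isHomogeneous_coeff_sumAlgEquiv hm (by omega)
    have hs : (∑ i : σ, (X i : MvPolynomial σ ℂ)).IsHomogeneous 1 :=
      IsHomogeneous.sum _ _ _ fun i _ => isHomogeneous_X _ _
    have h5 := eq_zero_of_mem_span_of_degree_lt
      (isHomogeneous_consPow (by simpa using hs.pow (c + 1)))
      ((isHomogeneous_monomial (R := ℂ) 1 (Finsupp.degree_single s (e.degree - 3))).mul h4)
      (by omega) h3
    rw [mul_eq_zero, monomial_eq_zero] at h5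
    rw [h5.resolve_left one_ne_zero]
    exact Ideal.zero_mem _

theorem exists_koszul_special {c D : ℕ} (hu : 2 * D + (c + 1) ≤ Fintype.card σ * c)
    {y : Option (τ ⊕ σ) → MvPolynomial (τ ⊕ σ) ℂ} (hy : (y none).IsHomogeneous D)
    (h : ∑ l, y l * consPow (sumPow τ σ (c + 1)) (c + 1) l = 0) :
    ∃ b : Option (τ ⊕ σ) → Option (τ ⊕ σ) → MvPolynomial (τ ⊕ σ) ℂ,
      ∀ l, y l = ∑ m, (b l m - b m l) * consPow (sumPow τ σ (c + 1)) (c + 1) m :=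
  exists_koszul_consPow h (mem_powIdeal_of_sumPow_mul_mem hu hy)

theorem eq_zero_of_syzygy_special {c D : ℕ} (hu : 2 * D + (c + 1) ≤ Fintype.card σ * c)
    (hD : D ≤ c) {y : Option (τ ⊕ σ) → MvPolynomial (τ ⊕ σ) ℂ} (hy : ∀ l, (y l).IsHomogeneous D)
    (h : ∑ l, y l * consPow (sumPow τ σ (c + 1)) (c + 1) l = 0) : y = 0 := by
  obtain ⟨b, hb⟩ := exists_koszul_special hu (hy none) h
  ext1 l
  refine eq_zero_of_mem_span_of_degree_lt (isHomogeneous_consPow (isHomogeneous_sumPow (c + 1)))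
    (hy l) (Nat.lt_succ_of_le hD) ?_
  rw [hb l]
  exact Ideal.sum_mem _ fun m _ => Ideal.mul_mem_left _ _ (Ideal.subset_span ⟨m, rfl⟩)

theorem exists_isHomogeneous_koszul_special {c D : ℕ}
    (hu : 2 * (D + (c + 1)) + (c + 1) ≤ Fintype.card σ * c)
    {y : Option (τ ⊕ σ) → MvPolynomial (τ ⊕ σ) ℂ} (hy : ∀ l, (y l).IsHomogeneous (D + (c + 1)))
    (h : ∑ l, y l * consPow (sumPow τ σ (c + 1)) (c + 1) l = 0) :
    ∃ b : Option (τ ⊕ σ) → Option (τ ⊕ σ) → MvPolynomial (τ ⊕ σ) ℂ,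
      (∀ l m, (b l m).IsHomogeneous D) ∧
      ∀ l, y l = ∑ m, (b l m - b m l) * consPow (sumPow τ σ (c + 1)) (c + 1) m := by
  obtain ⟨b, hb⟩ := exists_koszul_special hu (hy none) h
  refine ⟨fun l m => homogeneousComponent D (b l m),
    fun l m => homogeneousComponent_isHomogeneous _ _, fun l => ?_⟩
  rw [← homogeneousComponent_eq_self (hy l), hb l, map_sum]
  refine Finset.sum_congr rfl fun m _ => ?_
  rw [homogeneousComponent_mul_isHomogeneous
    (isHomogeneous_consPow (isHomogeneous_sumPow (c + 1)) m), map_sub]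

end SpecialForms

section PolynomialFamilies

variable {Y : Type} [AddCommGroup Y] [Module ℂ Y]

lemma IsPolyFun.add {φ ψ : Y → ℂ} (hφ : IsPolyFun φ) (hψ : IsPolyFun ψ) :
    IsPolyFun fun y => φ y + ψ y :=
  Subalgebra.add_mem _ hφ hψ

lemma IsPolyFun.mul {φ ψ : Y → ℂ} (hφ : IsPolyFun φ) (hψ : IsPolyFun ψ) :
    IsPolyFun fun y => φ y * ψ y :=
  Subalgebra.mul_mem _ hφ hψ

lemma IsPolyFun.const (r : ℂ) : IsPolyFun fun _ : Y => r :=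
  Subalgebra.algebraMap_mem _ r

lemma IsPolyFun.linear (l : Y →ₗ[ℂ] ℂ) : IsPolyFun fun y => l y :=
  Algebra.subset_adjoin ⟨l, rfl⟩

lemma IsPolyFun.sum {ι : Type*} {s : Finset ι} {φ : ι → Y → ℂ} (h : ∀ i ∈ s, IsPolyFun (φ i)) :
    IsPolyFun fun y => ∑ i ∈ s, φ i y := by
  have := Subalgebra.sum_mem _ h
  rwa [Finset.sum_fn] at this

lemma IsPolyFun.prod {ι : Type*} {s : Finset ι} {φ : ι → Y → ℂ} (h : ∀ i ∈ s, IsPolyFun (φ i)) :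
    IsPolyFun fun y => ∏ i ∈ s, φ i y := by
  have := Subalgebra.prod_mem _ h
  rwa [Finset.prod_fn] at this

/-- Maps all of whose linear coordinates are polynomial functions. -/
def IsPolyMap {V : Type*} [AddCommGroup V] [Module ℂ V] (G : Y → V) : Prop :=
  ∀ l : V →ₗ[ℂ] ℂ, IsPolyFun fun y => l (G y)

section IsPolyMap

variable {V W : Type*} [AddCommGroup V] [Module ℂ V] [AddCommGroup W] [Module ℂ W]

lemma IsPolyMap.add {G G' : Y → V} (hG : IsPolyMap G) (hG' : IsPolyMap G') :
    IsPolyMap fun y => G y + G' y := fun l => by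
  simpa only [map_add] using (hG l).add (hG' l)

lemma IsPolyMap.comp {G : Y → V} (hG : IsPolyMap G) (f : V →ₗ[ℂ] W) :
    IsPolyMap fun y => f (G y) := fun l => hG (l ∘ₗ f)

lemma IsPolyMap.prodMk {G : Y → V} {G' : Y → W} (hG : IsPolyMap G) (hG' : IsPolyMap G') :
    IsPolyMap fun y => (G y, G' y) := by
  simpa using (hG.comp (LinearMap.inl ℂ V W)).add (hG'.comp (LinearMap.inr ℂ V W))

lemma IsPolyMap.pi {ι : Type*} [Finite ι] {V : ι → Type*} [∀ i, AddCommGroup (V i)]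
    [∀ i, Module ℂ (V i)] {G : Y → ∀ i, V i} (hG : ∀ i, IsPolyMap fun y => G y i) :
    IsPolyMap G := fun l => by
  classical
  cases nonempty_fintype ι
  have h : ∀ y, l (G y) = ∑ i, (l ∘ₗ LinearMap.single ℂ V i) (G y i) := by
    intro y
    conv_lhs => rw [← Finset.univ_sum_single (G y), map_sum]
    rfl
  simp only [h]
  exact IsPolyFun.sum fun i _ => hG i _

lemma IsPolyMap.of_subtype {p : Submodule ℂ V} {G : Y → p} (hG : IsPolyMap fun y => (G y : V)) :
    IsPolyMap G := fun l => by
  obtain ⟨g, hg⟩ := LinearMap.exists_extend l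
  simpa [← hg] using hG g

/-- Exactness of a complex depending polynomially on a parameter is an open condition. -/
lemma exists_isPolyFun_exact {V₁ V₂ V₃ : Type*} [AddCommGroup V₁] [Module ℂ V₁]
    [AddCommGroup V₂] [Module ℂ V₂] [FiniteDimensional ℂ V₂] [AddCommGroup V₃] [Module ℂ V₃]
    (α : Y → V₁ →ₗ[ℂ] V₂) (β : Y → V₂ →ₗ[ℂ] V₃) (hα : ∀ v, IsPolyMap fun y => α y v)
    (hβ : ∀ v, IsPolyMap fun y => β y v) (hβα : ∀ y v, β y (α y v) = 0) (y₀ : Y)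
    (h₀ : ∀ v, β y₀ v = 0 → ∃ w, α y₀ w = v) :
    ∃ φ : Y → ℂ, IsPolyFun φ ∧ φ y₀ ≠ 0 ∧
      ∀ y, φ y ≠ 0 → ∀ v, β y v = 0 → ∃ w, α y w = v := by
  classical
  obtain ⟨r, hr⟩ := (β y₀).rangeRestrict.exists_rightInverse_of_surjective
    (LinearMap.range_eq_top.2 (β y₀).surjective_rangeRestrict)
  obtain ⟨t, ht⟩ := LinearMap.exists_extend r
  have htβ : ∀ v, β y₀ (t (β y₀ v)) = β y₀ v := by
    intro v
    have h1 := DFunLike.congr_fun hr ((β y₀).rangeRestrict v)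
    have h2 := DFunLike.congr_fun ht ((β y₀).rangeRestrict v)
    simp only [LinearMap.comp_apply, LinearMap.id_apply, Submodule.subtype_apply] at h1 h2
    have h3 := congrArg Subtype.val h1
    rw [← h2] at h3
    simpa using h3
  let α₀ : V₁ →ₗ[ℂ] LinearMap.ker (β y₀) := (α y₀).codRestrict _ fun v => hβα y₀ v
  obtain ⟨s₀, hs₀⟩ := α₀.exists_rightInverse_of_surjective <| by
    rw [LinearMap.range_eq_top]
    intro v
    obtain ⟨w, hw⟩ := h₀ v v.2
    exact ⟨w, Subtype.ext hw⟩
  let s : V₂ →ₗ[ℂ] V₁ := s₀ ∘ₗ (LinearMap.id - t ∘ₗ β y₀).codRestrict (LinearMap.ker (β y₀))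
    fun v => by simp [htβ]
  let Θ : Y → V₂ →ₗ[ℂ] V₂ := fun y => α y ∘ₗ s + t ∘ₗ β y
  have hΘ : ∀ y v, Θ y v = α y (s v) + t (β y v) := fun y v => rfl
  have hΘ₀ : Θ y₀ = LinearMap.id := by
    ext v
    have h1 := congrArg Subtype.val (DFunLike.congr_fun hs₀
      ((LinearMap.id - t ∘ₗ β y₀).codRestrict (LinearMap.ker (β y₀)) (fun v => by simp [htβ]) v))
    have h2 : α y₀ (s v) = v - t (β y₀ v) := h1
    rw [hΘ, h2]
    simp
  refine ⟨fun y => LinearMap.det (Θ y), ?_, by simp [hΘ₀], fun y hy v hv => ?_⟩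
  · let b := Module.finBasis ℂ V₂
    simp only [← LinearMap.det_toMatrix b, Matrix.det_apply, Units.smul_def, zsmul_eq_mul]
    refine IsPolyFun.sum fun σ _ => (IsPolyFun.const _).mul (IsPolyFun.prod fun i _ => ?_)
    simp only [LinearMap.toMatrix_apply, hΘ]
    exact ((hα _).add ((hβ _).comp t)) (b.coord _)
  · have hinj : Function.Injective (Θ y) :=
      LinearMap.ker_eq_bot.1 (by_contra fun h => hy (LinearMap.det_eq_zero_iff_ker_ne_bot.2 h))
    let Ψ : LinearMap.ker (β y) →ₗ[ℂ] LinearMap.ker (β y) :=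
      (Θ y).restrict fun w hw => by
        rw [LinearMap.mem_ker] at hw ⊢
        rw [hΘ, hw, map_zero, add_zero, hβα]
    have hΨ : Function.Injective Ψ := fun w w' h => Subtype.ext (hinj (congrArg Subtype.val h))
    obtain ⟨w, hw⟩ := (LinearMap.injective_iff_surjective.1 hΨ) ⟨v, hv⟩
    refine ⟨s w, ?_⟩
    have h1 : Θ y w = v := congrArg Subtype.val hw
    rwa [hΘ, show β y w = 0 from w.2, map_zero, add_zero] at h1

end IsPolyMap

variable {κ : Type*}

/-- Families of polynomials whose coefficients are polynomial functions of the parameter. -/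
def IsPolyFamily (G : Y → MvPolynomial κ ℂ) : Prop :=
  ∀ e, IsPolyFun fun y => coeff e (G y)

namespace IsPolyFamily

variable {G G' : Y → MvPolynomial κ ℂ}

lemma const (p : MvPolynomial κ ℂ) : IsPolyFamily fun _ : Y => p := fun _ => IsPolyFun.const _

lemma add (hG : IsPolyFamily G) (hG' : IsPolyFamily G') : IsPolyFamily fun y => G y + G' y :=
  fun e => by simpa only [coeff_add] using (hG e).add (hG' e)

lemma smul {φ : Y → ℂ} (hφ : IsPolyFun φ) (hG : IsPolyFamily G) :
    IsPolyFamily fun y => φ y • G y :=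
  fun e => by simpa only [coeff_smul, smul_eq_mul] using hφ.mul (hG e)

lemma neg (hG : IsPolyFamily G) : IsPolyFamily fun y => - G y := by
  simpa using smul (IsPolyFun.const (-1)) hG

lemma sub (hG : IsPolyFamily G) (hG' : IsPolyFamily G') : IsPolyFamily fun y => G y - G' y := by
  simpa only [sub_eq_add_neg] using hG.add hG'.neg

lemma mul (hG : IsPolyFamily G) (hG' : IsPolyFamily G') : IsPolyFamily fun y => G y * G' y := by
  classical
  intro e
  simp only [coeff_mul]
  exact IsPolyFun.sum fun x _ => (hG _).mul (hG' _)

lemma sum {ι : Type*} {s : Finset ι} {G : ι → Y → MvPolynomial κ ℂ}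
    (hG : ∀ i ∈ s, IsPolyFamily (G i)) : IsPolyFamily fun y => ∑ i ∈ s, G i y := fun e => by
  simpa only [coeff_sum] using IsPolyFun.sum fun i hi => hG i hi e

lemma isPolyMap [Finite κ] (hG : IsPolyFamily G) {k : ℕ} (hk : ∀ y, (G y).IsHomogeneous k) :
    IsPolyMap G := fun l => by
  classical
  cases nonempty_fintype κ
  have hfin : {e : κ →₀ ℕ | e.degree ≤ k}.Finite := Finsupp.finite_of_degree_le k
  have h : ∀ y, l (G y) = ∑ e ∈ hfin.toFinset, coeff e (G y) * l (monomial e 1) := by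
    intro y
    conv_lhs => rw [← support_sum_monomial_coeff (G y)]
    rw [Finset.sum_subset (s₂ := hfin.toFinset), map_sum]
    · refine Finset.sum_congr rfl fun e _ => ?_
      rw [← mul_one (coeff e (G y)), ← smul_eq_mul, ← smul_monomial, map_smul, smul_eq_mul,
        smul_eq_mul, mul_one]
    · intro e he
      have := hk y (mem_support_iff.1 he)
      rw [weight_one_eq_degree] at this
      simp [this]
    · intro e _ he
      rw [notMem_support_iff.1 he, monomial_zero]
  simp only [h]
  exact IsPolyFun.sum fun e _ => (hG e).mul (IsPolyFun.const _)

end IsPolyFamily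

end PolynomialFamilies

section GenericConditions

variable {Y : Type} [AddCommGroup Y] [Module ℂ Y] {κ L ι : Type*} [Finite κ] [Fintype L]
  {a : ℕ} {F : Y → L → MvPolynomial κ ℂ}

instance (k : ℕ) : FiniteDimensional ℂ (homogeneousSubmodule κ ℂ k) :=
  Module.Finite.iff_fg.2 (homogeneousSubmodule_fg _ _ _)

/-- Absence of syzygies in a fixed degree is an open condition. -/
lemma exists_isPolyFun_syzygy_eq_zero (hF : ∀ y l, (F y l).IsHomogeneous a)
    (hF' : ∀ l, IsPolyFamily fun y => F y l) (k : ℕ) (y₀ : Y)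
    (h₀ : ∀ q : L → MvPolynomial κ ℂ, (∀ l, (q l).IsHomogeneous k) →
      ∑ l, q l * F y₀ l = 0 → q = 0) :
    ∃ φ : Y → ℂ, IsPolyFun φ ∧ φ y₀ ≠ 0 ∧ ∀ y, φ y ≠ 0 →
      ∀ q : L → MvPolynomial κ ℂ, (∀ l, (q l).IsHomogeneous k) →
        ∑ l, q l * F y l = 0 → q = 0 := by
  let β : Y → (L → homogeneousSubmodule κ ℂ k) →ₗ[ℂ] MvPolynomial κ ℂ := fun y =>
    { toFun := fun q => ∑ l, (q l : MvPolynomial κ ℂ) * F y l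
      map_add' := fun q q' => by
        simp [add_mul, Finset.sum_add_distrib]
      map_smul' := fun r q => by
        simp [Finset.smul_sum] }
  obtain ⟨φ, hφ, hφ₀, h⟩ := exists_isPolyFun_exact (V₁ := ℂ) (fun _ => 0) β
    (fun v => fun l => by simpa using IsPolyFun.const 0) (fun v => by
      refine IsPolyFamily.isPolyMap (k := k + a) (IsPolyFamily.sum fun l _ =>
        (IsPolyFamily.const _).mul (hF' l)) fun y =>
          IsHomogeneous.sum _ _ _ fun l _ => (v l).2.mul (hF y l)) (fun y v => by simp) y₀
    (fun v hv => ⟨0, by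
      have := h₀ (fun l => (v l : MvPolynomial κ ℂ)) (fun l => (v l).2) hv
      ext l : 2
      exact (congrFun this l).symm⟩)
  refine ⟨φ, hφ, hφ₀, fun y hy q hq hq0 => ?_⟩
  obtain ⟨w, hw⟩ := h y hy (fun l => ⟨q l, hq l⟩) hq0
  ext1 l
  exact congrArg Subtype.val (congrFun hw.symm l)

/-- If `F y₀` has only Koszul syzygies in the relevant degree, then the absence of elements
of degree `k + a` multiplied into the ideal of `F y` by all `Q i` is open at `y₀`. -/
lemma exists_isPolyFun_colon (hF : ∀ y l, (F y l).IsHomogeneous a)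
    (hF' : ∀ l, IsPolyFamily fun y => F y l) (k : ℕ) [Finite ι] (Q : ι → MvPolynomial κ ℂ)
    (hQ : ∀ i, (Q i).IsHomogeneous a) (y₀ : Y)
    (hK : ∀ q : L → MvPolynomial κ ℂ, (∀ l, (q l).IsHomogeneous (k + a)) →
      ∑ l, q l * F y₀ l = 0 → ∃ c : L → L → MvPolynomial κ ℂ,
        (∀ l m, (c l m).IsHomogeneous k) ∧ ∀ l, q l = ∑ m, (c l m - c m l) * F y₀ m)
    (h₀ : ∀ m : MvPolynomial κ ℂ, m.IsHomogeneous (k + a) →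
      (∀ i, Q i * m ∈ Ideal.span (Set.range (F y₀))) → m ∈ Ideal.span (Set.range (F y₀))) :
    ∃ φ : Y → ℂ, IsPolyFun φ ∧ φ y₀ ≠ 0 ∧ ∀ y, φ y ≠ 0 →
      ∀ m : MvPolynomial κ ℂ, m.IsHomogeneous (k + a) →
        (∀ i, Q i * m ∈ Ideal.span (Set.range (F y))) → m ∈ Ideal.span (Set.range (F y)) := by
  have hQ' : ∀ {i} {b : MvPolynomial κ ℂ} {j}, b.IsHomogeneous j → (Q i * b).IsHomogeneous (j + a) :=
    fun hb => by simpa [add_comm] using (hQ _).mul hb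
  let α : Y → ((L → homogeneousSubmodule κ ℂ k) × (ι → L → L → homogeneousSubmodule κ ℂ k)) →ₗ[ℂ]
      (homogeneousSubmodule κ ℂ (k + a) × (ι → L → homogeneousSubmodule κ ℂ (k + a))) := fun y =>
    { toFun := fun w =>
        (⟨∑ l, (w.1 l : MvPolynomial κ ℂ) * F y l,
          IsHomogeneous.sum _ _ _ fun l _ => (w.1 l).2.mul (hF y l)⟩,
        fun i l => ⟨Q i * w.1 l +
            ∑ m, ((w.2 i l m : MvPolynomial κ ℂ) - w.2 i m l) * F y m,
          (hQ' (w.1 l).2).add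
            (IsHomogeneous.sum _ _ _ fun m _ => ((w.2 i l m).2.sub (w.2 i m l).2).mul (hF y m))⟩)
      map_add' := fun w w' => by
        refine Prod.ext (Subtype.ext ?_) (funext fun i => funext fun l => Subtype.ext ?_)
        · simp [add_mul, Finset.sum_add_distrib]
        · simp only [Prod.fst_add, Prod.snd_add, Pi.add_apply, Submodule.coe_add]
          rw [add_add_add_comm, ← Finset.sum_add_distrib, ← mul_add]
          congr 1
          exact Finset.sum_congr rfl fun m _ => by ring
      map_smul' := fun r w => by
        refine Prod.ext (Subtype.ext ?_) (funext fun i => funext fun l => Subtype.ext ?_)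
        · simp [Finset.smul_sum]
        · simp [Finset.smul_sum, smul_add, ← smul_sub] }
  let β : Y → (homogeneousSubmodule κ ℂ (k + a) × (ι → L → homogeneousSubmodule κ ℂ (k + a))) →ₗ[ℂ]
      (ι → MvPolynomial κ ℂ) := fun y =>
    { toFun := fun v i => Q i * v.1 - ∑ l, (v.2 i l : MvPolynomial κ ℂ) * F y l
      map_add' := fun v v' => by
        ext1 i
        simp only [Prod.fst_add, Prod.snd_add, Pi.add_apply, Submodule.coe_add, add_mul,
          Finset.sum_add_distrib]
        ring
      map_smul' := fun r v => by
        ext1 i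
        simp [Finset.smul_sum, smul_sub] }
  have hα : ∀ w, IsPolyMap fun y => α y w := by
    intro w
    refine IsPolyMap.prodMk (IsPolyMap.of_subtype ?_)
      (IsPolyMap.pi fun i => IsPolyMap.pi fun l => IsPolyMap.of_subtype ?_)
    · exact IsPolyFamily.isPolyMap (IsPolyFamily.sum fun l _ => (IsPolyFamily.const _).mul (hF' l))
        fun y => (α y w).1.2
    · exact IsPolyFamily.isPolyMap ((IsPolyFamily.const _).add
        (IsPolyFamily.sum fun l _ => (IsPolyFamily.const _).mul (hF' l)))
        fun y => ((α y w).2 i l).2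
  have hβ : ∀ v, IsPolyMap fun y => β y v := by
    intro v
    refine IsPolyMap.pi fun i => IsPolyFamily.isPolyMap (k := k + a + a) ((IsPolyFamily.const _).sub
        (IsPolyFamily.sum fun l _ => (IsPolyFamily.const _).mul (hF' l))) fun y => ?_
    exact (hQ' v.1.2).sub (IsHomogeneous.sum _ _ _ fun l _ => (v.2 i l).2.mul (hF y l))
  have hβα : ∀ y w, β y (α y w) = 0 := by
    intro y w
    ext1 i
    change Q i * (∑ l, (w.1 l : MvPolynomial κ ℂ) * F y l) - ∑ l, (Q i * w.1 l +
      ∑ m, ((w.2 i l m : MvPolynomial κ ℂ) - w.2 i m l) * F y m) * F y l = 0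
    have h1 : ∑ l, ∑ m, (w.2 i m l : MvPolynomial κ ℂ) * (F y m * F y l) =
        ∑ l, ∑ m, (w.2 i l m : MvPolynomial κ ℂ) * (F y m * F y l) := by
      rw [Finset.sum_comm]
      exact Finset.sum_congr rfl fun l _ => Finset.sum_congr rfl fun m _ => by ring
    simp only [add_mul, sub_mul, Finset.sum_add_distrib, Finset.sum_mul, Finset.sum_sub_distrib,
      Finset.mul_sum, mul_assoc, h1, sub_self, add_zero]
  obtain ⟨φ, hφ, hφ₀, h⟩ := exists_isPolyFun_exact α β hα hβ hβα y₀ <| by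
    rintro ⟨m, A⟩ hv
    have hv' : ∀ i, Q i * m = ∑ l, (A i l : MvPolynomial κ ℂ) * F y₀ l := fun i =>
      sub_eq_zero.1 (congrFun hv i)
    obtain ⟨b, hb, hmb⟩ := exists_isHomogeneous_coeff (hF y₀) m.2 <| h₀ m m.2 fun i => by
      rw [hv' i]
      exact Ideal.sum_mem _ fun l _ => Ideal.mul_mem_left _ _ (Ideal.subset_span ⟨l, rfl⟩)
    have hc : ∀ i, ∃ c : L → L → MvPolynomial κ ℂ, (∀ l m, (c l m).IsHomogeneous k) ∧
        ∀ l, (A i l : MvPolynomial κ ℂ) - Q i * b l = ∑ m, (c l m - c m l) * F y₀ m := by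
      intro i
      refine hK _ (fun l => (A i l).2.sub (hQ' (hb l))) ?_
      simp only [sub_mul, Finset.sum_sub_distrib, ← hv', mul_assoc, ← Finset.mul_sum, ← hmb,
        sub_self]
    choose c hc hAc using hc
    refine ⟨(fun l => ⟨b l, hb l⟩, fun i l m => ⟨c i l m, hc i l m⟩), ?_⟩
    refine Prod.ext (Subtype.ext hmb.symm) (funext fun i => funext fun l => Subtype.ext ?_)
    change Q i * b l + ∑ m, (c i l m - c i m l) * F y₀ m = A i l
    rw [← hAc, add_sub_cancel]
  refine ⟨φ, hφ, hφ₀, fun y hy m hm hQm => ?_⟩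
  have hA : ∀ i, ∃ A : L → MvPolynomial κ ℂ, (∀ l, (A l).IsHomogeneous (k + a)) ∧
      Q i * m = ∑ l, A l * F y l := fun i =>
    exists_isHomogeneous_coeff (hF y) (hQ' hm) (hQm i)
  choose A hA hQA using hA
  obtain ⟨w, hw⟩ := h y hy (⟨m, hm⟩, fun i l => ⟨A i l, hA i l⟩)
    (funext fun i => sub_eq_zero.2 (hQA i))
  have h1 : ∑ l, (w.1 l : MvPolynomial κ ℂ) * F y l = m :=
    congrArg (fun v => (v.1 : MvPolynomial κ ℂ)) hw
  rw [← h1]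
  exact Ideal.sum_mem _ fun l _ => Ideal.mul_mem_left _ _ (Ideal.subset_span ⟨l, rfl⟩)

end GenericConditions

section Cocycles

variable {κ : Type*}

lemma X_dvd_of_X_dvd_X_mul {i k : κ} (h : i ≠ k) {p : MvPolynomial κ ℂ} (hp : X i ∣ X k * p) :
    (X i : MvPolynomial κ ℂ) ∣ p :=
  (X_prime.dvd_or_dvd hp).resolve_left fun h' => h (X_dvd_X.1 h')

lemma exists_eq_X_mul_of_cocycle [Nontrivial κ] {p : κ → MvPolynomial κ ℂ}
    (h : ∀ i k, X i * p k = X k * p i) : ∃ r, ∀ k, p k = X k * r := by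
  obtain ⟨i, k, hik⟩ := exists_pair_ne κ
  obtain ⟨r, hr⟩ := X_dvd_of_X_dvd_X_mul hik ⟨p k, (h i k).symm⟩
  refine ⟨r, fun j => mul_left_cancel₀ (X_ne_zero i) ?_⟩
  rw [h, hr, mul_left_comm]

lemma exists_eq_sub_of_cocycle {q : κ → κ → MvPolynomial κ ℂ}
    (hq : ∀ i k m, X m * q i k + X i * q k m + X k * q m i = 0) {u v w : κ} (huv : u ≠ v)
    (huw : u ≠ w) (hvw : v ≠ w) : ∃ s : κ → MvPolynomial κ ℂ, ∀ i k, q i k = X i * s k - X k * s i := by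
  have hdiag : ∀ i, q i i = 0 := fun i => by
    have h3 : (3 : MvPolynomial κ ℂ) * (X i * q i i) = 0 := by linear_combination hq i i i
    simpa [X_ne_zero] using h3
  have hanti : ∀ i k, q k i = - q i k := fun i k => by
    refine mul_left_cancel₀ (X_ne_zero k) ?_
    linear_combination hq i k k - X i * hdiag k
  obtain ⟨s₀, r, hsr⟩ : ∃ s₀ r, s₀ * X u + r * X v = q u v := by
    rw [← Ideal.mem_span_pair]
    have h1 := mem_span_of_X_pow_mul_mem (a := 1) (s := {u, v}) (i := w) (p := q u v)
      (by simp [huw.symm, hvw.symm])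
    simp only [pow_one, Set.image_pair] at h1
    refine h1 (Ideal.mem_span_pair.2 ⟨- q v w, - q w u, ?_⟩)
    linear_combination - hq u v w
  have hs : ∀ i, ∃ s, q u i = X i * r + X u * s := by
    intro i
    obtain ⟨s, hs⟩ := X_dvd_of_X_dvd_X_mul huv (p := q u i - X i * r)
      ⟨X i * s₀ + q v i, by linear_combination - hq u v i + X v * hanti u i - X i * hsr⟩
    exact ⟨s, by linear_combination hs⟩
  choose s hs using hs
  refine ⟨s, fun i k => mul_left_cancel₀ (X_ne_zero u) ?_⟩
  linear_combination hq i k u + X i * hs k - X k * hs i - X i * hanti u k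

end Cocycles

section Syzygies

variable {κ L : Type*} [Fintype L] {a : ℕ} {F : L → MvPolynomial κ ℂ}

/-- The forms `F l` have no nontrivial syzygies with coefficients of degree `3`. -/
def NoCubicSyzygy (F : L → MvPolynomial κ ℂ) : Prop :=
  ∀ q : L → MvPolynomial κ ℂ, (∀ l, (q l).IsHomogeneous 3) → ∑ l, q l * F l = 0 → q = 0

lemma NoCubicSyzygy.eq_zero [Nonempty κ] (hF : NoCubicSyzygy F) {e : ℕ} (he : e ≤ 3)
    {q : L → MvPolynomial κ ℂ} (hq : ∀ l, (q l).IsHomogeneous e) (h : ∑ l, q l * F l = 0) :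
    ∀ l, q l = 0 := by
  obtain ⟨i⟩ := ‹Nonempty κ›
  intro l
  have h1 := hF (fun l => X i ^ (3 - e) * q l)
    (fun l => by
      have := (isHomogeneous_X_pow (R := ℂ) i (3 - e)).mul (hq l)
      rwa [Nat.sub_add_cancel he] at this)
    (by simp only [mul_assoc, ← Finset.mul_sum, h, mul_zero])
  exact (mul_eq_zero.1 (congrFun h1 l)).resolve_left (pow_ne_zero _ (X_ne_zero i))

lemma sum_mul_mem_span (F : L → MvPolynomial κ ℂ) (s : L → MvPolynomial κ ℂ) :
    ∑ l, s l * F l ∈ Ideal.span (Set.range F) :=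
  Ideal.sum_mem _ fun l _ => Ideal.mul_mem_left _ _ (Ideal.subset_span ⟨l, rfl⟩)

variable [Nontrivial κ]

theorem NoCubicSyzygy.mem_span_of_X_mul_mem (hF : NoCubicSyzygy F)
    (hFa : ∀ l, (F l).IsHomogeneous a) {j : ℕ} (hj : j ≤ a + 1) {m : MvPolynomial κ ℂ}
    (hm : m.IsHomogeneous j) (h : ∀ k, X k * m ∈ Ideal.span (Set.range F)) :
    m ∈ Ideal.span (Set.range F) := by
  have hXm : ∀ k, (X k * m : MvPolynomial κ ℂ).IsHomogeneous (j + 1) := fun k => by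
    simpa [add_comm] using (isHomogeneous_X ℂ k).mul hm
  rcases lt_or_ge (j + 1) a with hja | hja
  · obtain ⟨k⟩ : Nonempty κ := inferInstance
    have h1 := eq_zero_of_mem_span_of_degree_lt hFa (hXm k) hja (h k)
    rw [(mul_eq_zero.1 h1).resolve_left (X_ne_zero k)]
    exact Ideal.zero_mem _
  · obtain ⟨e, he⟩ := Nat.exists_eq_add_of_le' hja
    choose q hq hqm using fun k => exists_isHomogeneous_coeff hFa (he ▸ hXm k) (h k)
    have h1 : ∀ i k l, X i * q k l - X k * q i l = 0 := by
      intro i k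
      refine hF.eq_zero (e := 1 + e) (by omega)
        (fun l => ((isHomogeneous_X ℂ i).mul (hq k l)).sub ((isHomogeneous_X ℂ k).mul (hq i l))) ?_
      simp only [sub_mul, Finset.sum_sub_distrib, mul_assoc, ← Finset.mul_sum, ← hqm]
      ring
    choose r hr using fun l => exists_eq_X_mul_of_cocycle (p := fun k => q k l)
      fun i k => sub_eq_zero.1 (h1 i k l)
    obtain ⟨k⟩ : Nonempty κ := inferInstance
    have h2 : m = ∑ l, r l * F l := by
      refine mul_left_cancel₀ (X_ne_zero k) ?_
      rw [hqm k, Finset.mul_sum]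
      exact Finset.sum_congr rfl fun l _ => by rw [hr, mul_assoc]
    rw [h2]
    exact sum_mul_mem_span F r

theorem NoCubicSyzygy.exists_sub_X_mul_mem (hF : NoCubicSyzygy F)
    (hFa : ∀ l, (F l).IsHomogeneous a) {u v w : κ} (huv : u ≠ v)
    (huw : u ≠ w) (hvw : v ≠ w) {j : ℕ} (hj : j ≤ a) {p : κ → MvPolynomial κ ℂ}
    (hp : ∀ i, (p i).IsHomogeneous (j + 1))
    (h : ∀ i k, X i * p k - X k * p i ∈ Ideal.span (Set.range F)) :
    ∃ b : MvPolynomial κ ℂ, b.IsHomogeneous j ∧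
      ∀ i, p i - X i * b ∈ Ideal.span (Set.range F) := by
  suffices h' : ∃ b, ∀ i, p i - X i * b ∈ Ideal.span (Set.range F) by
    obtain ⟨b, hb⟩ := h'
    refine ⟨homogeneousComponent j b, homogeneousComponent_isHomogeneous _ _, fun i => ?_⟩
    have h1 := homogeneousComponent_mem_span hFa (j + 1) (hb i)
    rwa [map_sub, homogeneousComponent_eq_self (hp i), mul_comm,
      homogeneousComponent_mul_isHomogeneous (isHomogeneous_X ℂ i), mul_comm] at h1
  have hX : ∀ i k, (X i * p k - X k * p i).IsHomogeneous (j + 2) := fun i k => by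
    have h1 := ((isHomogeneous_X ℂ i).mul (hp k)).sub ((isHomogeneous_X ℂ k).mul (hp i))
    rwa [show 1 + (j + 1) = j + 2 by ring] at h1
  rcases lt_or_ge (j + 2) a with hja | hja
  · obtain ⟨b, hb⟩ := exists_eq_X_mul_of_cocycle (p := p) fun i k => sub_eq_zero.1
      (eq_zero_of_mem_span_of_degree_lt hFa (hX i k) hja (h i k))
    exact ⟨b, fun i => by simp [hb i]⟩
  · obtain ⟨e, he⟩ := Nat.exists_eq_add_of_le' hja
    choose q hq hqp using fun i k => exists_isHomogeneous_coeff hFa (he ▸ hX i k) (h i k)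
    have h1 : ∀ i k m l, X m * q i k l + X i * q k m l + X k * q m i l = 0 := by
      intro i k m
      refine hF.eq_zero (e := 1 + e) (by omega) (fun l => (((isHomogeneous_X ℂ m).mul
        (hq i k l)).add ((isHomogeneous_X ℂ i).mul (hq k m l))).add
        ((isHomogeneous_X ℂ k).mul (hq m i l))) ?_
      simp only [add_mul, Finset.sum_add_distrib, mul_assoc, ← Finset.mul_sum, ← hqp]
      ring
    choose s hs using fun l => exists_eq_sub_of_cocycle (q := fun i k => q i k l)
      (fun i k m => h1 i k m l) huv huw hvw
    obtain ⟨b, hb⟩ := exists_eq_X_mul_of_cocycle (p := fun k => p k - ∑ l, s l k * F l) <| by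
      intro i k
      have h2 := hqp i k
      simp only [hs, sub_mul, Finset.sum_sub_distrib, mul_assoc, ← Finset.mul_sum] at h2
      linear_combination h2
    refine ⟨b, fun i => ?_⟩
    rw [← hb i, sub_sub_cancel]
    exact sum_mul_mem_span F fun l => s l i

end Syzygies

section LinearMapsModulo

variable {ρ : Type*}

/-- An element of degree at most `N` killed by all variables modulo `J` lies in `J`. -/
def SocleVanishes (J : Ideal (MvPolynomial ρ ℂ)) (N : ℕ) : Prop :=
  ∀ j ≤ N, ∀ m : MvPolynomial ρ ℂ, m.IsHomogeneous j → (∀ i, X i * m ∈ J) → m ∈ J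

/-- Compatible tuples of degree at most `N + 1` modulo `J` are multiples of the tuple of
variables. -/
def TuplesDivisible (J : Ideal (MvPolynomial ρ ℂ)) (N : ℕ) : Prop :=
  ∀ j ≤ N, ∀ p : ρ → MvPolynomial ρ ℂ, (∀ i, (p i).IsHomogeneous (j + 1)) →
    (∀ i k, X i * p k - X k * p i ∈ J) →
      ∃ b : MvPolynomial ρ ℂ, b.IsHomogeneous j ∧ ∀ i, p i - X i * b ∈ J

lemma exists_linearMap_of_forall_exists {V W U : Type*} [AddCommGroup V] [Module ℂ V]
    [AddCommGroup W] [Module ℂ W] [AddCommGroup U] [Module ℂ U] (p : Submodule ℂ V)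
    (q : Submodule ℂ W) (f : V →ₗ[ℂ] U) (g : W →ₗ[ℂ] U) (h : ∀ v ∈ p, ∃ w ∈ q, g w = f v) :
    ∃ s : V →ₗ[ℂ] W, ∀ v ∈ p, s v ∈ q ∧ g (s v) = f v := by
  let b := Module.Free.chooseBasis ℂ p
  choose w hw hgw using fun i => h (b i) (b i).2
  obtain ⟨s, hs⟩ := LinearMap.exists_extend (b.constr ℂ w)
  have hs' : ∀ v : p, s v = b.constr ℂ w v := fun v => DFunLike.congr_fun hs v
  refine ⟨s, fun v hv => ⟨?_, ?_⟩⟩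
  · rw [hs' ⟨v, hv⟩, b.constr_apply]
    exact Submodule.sum_mem _ fun i _ => q.smul_mem _ (hw i)
  · have h1 : g ∘ₗ s ∘ₗ p.subtype = f ∘ₗ p.subtype := by
      refine b.ext fun i => ?_
      simp [hs', hgw]
    exact DFunLike.congr_fun h1 ⟨v, hv⟩

variable [Fintype ρ] {J : Ideal (MvPolynomial ρ ℂ)}

lemma exists_eq_sum_X_mul {k : ℕ} {B : MvPolynomial ρ ℂ} (hB : B.IsHomogeneous (k + 1)) :
    ∃ P : ρ → MvPolynomial ρ ℂ, (∀ i, (P i).IsHomogeneous k) ∧ B = ∑ i, X i * P i := by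
  refine ⟨fun i => (k + 1 : ℂ)⁻¹ • pderiv i B, fun i => ?_, ?_⟩
  · have h1 : (pderiv i B).IsHomogeneous k := hB.pderiv
    exact (homogeneousSubmodule ρ ℂ k).smul_mem _ h1
  · have h1 : (k + 1 : ℂ) ≠ 0 := by exact_mod_cast Nat.succ_ne_zero k
    simp only [mul_smul_comm, ← Finset.smul_sum, hB.sum_X_mul_pderiv]
    rw [← Nat.cast_smul_eq_nsmul ℂ, smul_smul]
    push_cast
    rw [inv_mul_cancel₀ h1, one_smul]

/-- A linear map compatible with the variables modulo `J` is multiplication by a linear form. -/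
theorem exists_forall_sub_mul_mem {N : ℕ} (hS : SocleVanishes J (N + 1))
    (hT : TuplesDivisible J N) : ∀ k ≤ N, ∀ h : MvPolynomial ρ ℂ →ₗ[ℂ] MvPolynomial ρ ℂ,
      (∀ B : MvPolynomial ρ ℂ, B.IsHomogeneous k → (h B).IsHomogeneous (k + 1)) →
      (∀ (P : MvPolynomial ρ ℂ) (j : ℕ), P.IsHomogeneous j → j + 1 = k →
        ∀ i l, X i * h (X l * P) - X l * h (X i * P) ∈ J) →
      ∃ y : MvPolynomial ρ ℂ, y.IsHomogeneous 1 ∧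
        ∀ B : MvPolynomial ρ ℂ, B.IsHomogeneous k → h B - y * B ∈ J
  | 0, _, h, hh, _ => by
    refine ⟨h 1, hh 1 (isHomogeneous_one _ _), fun B hB => ?_⟩
    rw [← totalDegree_zero_iff_isHomogeneous, totalDegree_eq_zero_iff_eq_C] at hB
    rw [hB, ← mul_one (C (coeff 0 B)), ← smul_eq_C_mul, map_smul, mul_smul_comm, mul_one, sub_self]
    exact J.zero_mem
  | k + 1, hk, h, hh, hc => by
    have hX : ∀ {j : ℕ} {P : MvPolynomial ρ ℂ} (i : ρ), P.IsHomogeneous j →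
        (X i * P).IsHomogeneous (j + 1) := fun i hP => by
      simpa [add_comm] using (isHomogeneous_X ℂ i).mul hP
    let f : MvPolynomial ρ ℂ →ₗ[ℂ] (ρ → MvPolynomial ρ ℂ ⧸ J) := LinearMap.pi fun i =>
      (Ideal.Quotient.mkₐ ℂ J).toLinearMap ∘ₗ h ∘ₗ LinearMap.mulLeft ℂ (X i)
    let f' : MvPolynomial ρ ℂ →ₗ[ℂ] (ρ → MvPolynomial ρ ℂ ⧸ J) := LinearMap.pi fun i =>
      (Ideal.Quotient.mkₐ ℂ J).toLinearMap ∘ₗ LinearMap.mulLeft ℂ (X i)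
    obtain ⟨g, hg⟩ := exists_linearMap_of_forall_exists (homogeneousSubmodule ρ ℂ k)
      (homogeneousSubmodule ρ ℂ (k + 1)) f f' <| by
        intro P hP
        obtain ⟨b, hb, hPb⟩ := hT (k + 1) hk (fun i => h (X i * P)) (fun i => hh _ (hX i hP))
          (hc P k hP rfl)
        exact ⟨b, hb, funext fun i => (Ideal.Quotient.eq.2 (hPb i)).symm⟩
    have hgX : ∀ P : MvPolynomial ρ ℂ, P.IsHomogeneous k → ∀ i, h (X i * P) - X i * g P ∈ J :=
      fun P hP i => Ideal.Quotient.eq.1 (congrFun (hg P hP).2 i).symm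
    obtain ⟨y, hy, hgy⟩ := exists_forall_sub_mul_mem hS hT k (Nat.le_of_succ_le hk) g
      (fun B hB => (hg B hB).1) <| by
        rintro P j hP rfl i l
        refine hS (j + 3) (by omega) _
          ((hX i (hg _ (hX l hP)).1).sub (hX l (hg _ (hX i hP)).1)) fun t => ?_
        have h1 := J.mul_mem_left (X i) (hgX _ (hX l hP) t)
        have h2 := J.mul_mem_left (X l) (hgX _ (hX i hP) t)
        have h3 := hc (X t * P) (j + 1) (hX t hP) rfl i l
        rw [mul_left_comm (X l) (X t), mul_left_comm (X i) (X t)] at h3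
        have h4 := J.add_mem (J.sub_mem h2 h1) h3
        convert h4 using 1
        ring
    refine ⟨y, hy, fun B hB => ?_⟩
    obtain ⟨P, hP, rfl⟩ := exists_eq_sum_X_mul hB
    rw [map_sum, Finset.mul_sum, ← Finset.sum_sub_distrib]
    refine J.sum_mem fun i _ => ?_
    have h1 := J.add_mem (hgX _ (hP i) i) (J.mul_mem_left (X i) (hgy _ (hP i)))
    convert h1 using 1
    ring

/-- If `J` satisfies the vanishing conditions, then every module morphism into `S/J` is
multiplication by a linear form. -/
theorem exists_linear_form_of_module_morphism {n a : ℕ} {J : Ideal (S n)}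
    (hS : SocleVanishes J (a + 1)) (hT : TuplesDivisible J a)
    (hA : ∀ m : S n, m.IsHomogeneous (a + 2) →
      (∀ Q : S n, Q.IsHomogeneous a → Q * m ∈ J) → m ∈ J)
    (h : homogeneousSubmodule (Fin (n + 1)) ℂ a →ₗ[ℂ] (S n ⧸ J))
    (hh : ∀ B, h B ∈ quotPiece J (a + 1))
    (h' : S n → S n ⧸ J)
    (hh' : ∀ (A : S n), A.IsHomogeneous (a + 1) →
      ∀ B : homogeneousSubmodule (Fin (n + 1)) ℂ a,
        h' (A * (B : S n)) = Ideal.Quotient.mk J A * h B) :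
    ∃ y : S n, y.IsHomogeneous 1 ∧ ∀ B : homogeneousSubmodule (Fin (n + 1)) ℂ a,
      h B = Ideal.Quotient.mk J (y * (B : S n)) := by
  have hX : ∀ {j : ℕ} {P : S n} (i : Fin (n + 1)), P.IsHomogeneous j →
      (X i * P).IsHomogeneous (j + 1) := fun i hP => by
    simpa [add_comm] using (isHomogeneous_X ℂ i).mul hP
  obtain ⟨h₁, hh₁⟩ := LinearMap.exists_extend h
  have hh₁ : ∀ B : homogeneousSubmodule (Fin (n + 1)) ℂ a, h₁ B = h B := fun B =>
    DFunLike.congr_fun hh₁ B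
  obtain ⟨g, hg⟩ := exists_linearMap_of_forall_exists (homogeneousSubmodule (Fin (n + 1)) ℂ a)
    (homogeneousSubmodule (Fin (n + 1)) ℂ (a + 1)) h₁ (Ideal.Quotient.mkₐ ℂ J).toLinearMap <| by
      intro B hB
      obtain ⟨w, hw, hwB⟩ := hh ⟨B, hB⟩
      exact ⟨w, hw, hwB.trans (hh₁ ⟨B, hB⟩).symm⟩
  have hgh : ∀ (B : S n) (hB : B.IsHomogeneous a), Ideal.Quotient.mk J (g B) = h ⟨B, hB⟩ :=
    fun B hB => (hg B hB).2.trans (hh₁ ⟨B, hB⟩)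
  obtain ⟨y, hy, hgy⟩ := exists_forall_sub_mul_mem hS hT a le_rfl g (fun B hB => (hg B hB).1) <| by
    rintro P j hP rfl i l
    refine hA _ ((hX i (hg _ (hX l hP)).1).sub (hX l (hg _ (hX i hP)).1)) fun Q hQ => ?_
    have h1 := hh' (X i * Q) (hX i hQ) ⟨_, hX l hP⟩
    have h2 := hh' (X l * Q) (hX l hQ) ⟨_, hX i hP⟩
    rw [← hgh, ← map_mul] at h1 h2
    have h3 : X i * Q * (X l * P) = X l * Q * (X i * P) := by ring
    simp only [h3] at h1
    have h4 := Ideal.Quotient.eq.1 (h1.symm.trans h2)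
    convert h4 using 1
    ring
  refine ⟨y, hy, fun B => ?_⟩
  rw [← hgh B B.2]
  exact Ideal.Quotient.eq.2 (hgy B B.2)

end LinearMapsModulo

section HyperplaneRestriction

variable {n : ℕ} {κ : Type*} [Fintype κ] (ε : Fin (n + 1) ≃ Option κ)

/-- The coefficient of the variable labelled by `l` in `x`. -/
def linCoeff (x : S n) (l : Option κ) : ℂ := coeff (Finsupp.single (ε.symm l) 1) x

/-- The image of the variable labelled by `l` under `hyperplaneRestrict`. -/
def restrictVar (x : S n) : Option κ → MvPolynomial κ ℂ
  | none => - ∑ k, linCoeff ε x (some k) • X k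
  | some k => linCoeff ε x none • X k

/-- Restriction to the hyperplane `x = 0`, parametrized so that it is polynomial in `x`. -/
def hyperplaneRestrict (x : S n) : S n →ₐ[ℂ] MvPolynomial κ ℂ :=
  aeval fun i => restrictVar ε x (ε i)

/-- A section of `hyperplaneRestrict`. -/
def hyperplaneSection (x : S n) : MvPolynomial κ ℂ →ₐ[ℂ] S n :=
  aeval fun k => (linCoeff ε x none)⁻¹ • X (ε.symm (some k))

@[simp]
lemma hyperplaneRestrict_X_symm (x : S n) (l : Option κ) :
    hyperplaneRestrict ε x (X (ε.symm l)) = restrictVar ε x l := by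
  simp [hyperplaneRestrict]

lemma isHomogeneous_restrictVar (x : S n) (l : Option κ) :
    (restrictVar ε x l).IsHomogeneous 1 := by
  cases l with
  | none =>
    exact (IsHomogeneous.sum _ _ _ fun k _ =>
      (homogeneousSubmodule κ ℂ 1).smul_mem _ (isHomogeneous_X ℂ k)).neg
  | some k => exact (homogeneousSubmodule κ ℂ 1).smul_mem _ (isHomogeneous_X ℂ k)

lemma isHomogeneous_hyperplaneRestrict (x : S n) {p : S n} {k : ℕ} (hp : p.IsHomogeneous k) :
    (hyperplaneRestrict ε x p).IsHomogeneous k := by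
  have h := hp.aeval _ fun i => isHomogeneous_restrictVar ε x (ε i)
  rwa [one_mul] at h

omit [Fintype κ] in
lemma isHomogeneous_hyperplaneSection (x : S n) {p : MvPolynomial κ ℂ} {k : ℕ}
    (hp : p.IsHomogeneous k) : (hyperplaneSection ε x p).IsHomogeneous k := by
  have h := hp.aeval _ fun i =>
    (homogeneousSubmodule (Fin (n + 1)) ℂ 1).smul_mem (linCoeff ε x none)⁻¹
      (isHomogeneous_X ℂ (ε.symm (some i)))
  rwa [one_mul] at h

lemma eq_sum_linCoeff {x : S n} (hx : x.IsHomogeneous 1) :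
    x = linCoeff ε x none • X (ε.symm none) +
      ∑ k, linCoeff ε x (some k) • X (ε.symm (some k)) := by
  have h : x = ∑ i, coeff (Finsupp.single i 1) x • X i := by
    classical
    obtain ⟨q, hq, h⟩ := exists_eq_sum_X_mul (k := 0) hx
    have hc : ∀ i, X i * q i = coeff 0 (q i) • X i := fun i => by
      nth_rewrite 1 [totalDegree_eq_zero_iff_eq_C.1 (Nat.le_zero.1 (hq i).totalDegree_le)]
      rw [mul_comm, smul_eq_C_mul]
    simp only [hc] at h
    conv_lhs => rw [h]
    refine Finset.sum_congr rfl fun i _ => ?_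
    rw [h]
    simp [coeff_sum, coeff_X, Finsupp.single_left_inj]
  conv_lhs => rw [h, ← Equiv.sum_comp ε.symm, Fintype.sum_option]
  rfl

lemma hyperplaneRestrict_self {x : S n} (hx : x.IsHomogeneous 1) :
    hyperplaneRestrict ε x x = 0 := by
  nth_rewrite 2 [eq_sum_linCoeff ε hx]
  simp [restrictVar, Finset.smul_sum, smul_comm (linCoeff ε x none)]

variable {x : S n} (hx : x.IsHomogeneous 1) (hx₀ : linCoeff ε x none ≠ 0)

include hx₀ in
lemma hyperplaneRestrict_hyperplaneSection (p : MvPolynomial κ ℂ) :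
    hyperplaneRestrict ε x (hyperplaneSection ε x p) = p := by
  have h : (hyperplaneRestrict ε x).comp (hyperplaneSection ε x) = AlgHom.id ℂ _ := by
    ext1 k
    simp [hyperplaneSection, restrictVar, smul_smul, hx₀]
  exact DFunLike.congr_fun h p

include hx hx₀ in
lemma hyperplaneSection_hyperplaneRestrict_sub_mem (p : S n) :
    p - hyperplaneSection ε x (hyperplaneRestrict ε x p) ∈ Ideal.span {x} := by
  have h : (Ideal.Quotient.mkₐ ℂ (Ideal.span {x})) =
      (Ideal.Quotient.mkₐ ℂ (Ideal.span {x})).comp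
        ((hyperplaneSection ε x).comp (hyperplaneRestrict ε x)) := by
    ext1 i
    obtain ⟨l, rfl⟩ := ε.symm.surjective i
    refine Ideal.Quotient.eq.2 ?_
    cases l with
    | some k => simp [hyperplaneSection, restrictVar, smul_smul, hx₀]
    | none =>
      refine Ideal.mem_span_singleton'.2 ⟨C (linCoeff ε x none)⁻¹, ?_⟩
      nth_rewrite 2 [eq_sum_linCoeff ε hx]
      simp [hyperplaneSection, restrictVar, ← smul_eq_C_mul, smul_smul, hx₀, Finset.smul_sum,
        mul_comm]
  exact Ideal.Quotient.eq.1 (DFunLike.congr_fun h p)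

/-- The restrictions of the partial derivatives of `f` to the hyperplane `x = 0`. -/
def restrictedPartials (f x : S n) (l : Option κ) : MvPolynomial κ ℂ :=
  hyperplaneRestrict ε x (pderiv (ε.symm l) f)

include hx hx₀ in
lemma mem_JX_iff {f p : S n} :
    p ∈ JX f x ↔
      hyperplaneRestrict ε x p ∈ Ideal.span (Set.range (restrictedPartials ε f x)) := by
  constructor
  · intro hp
    have h : JX f x ≤ (Ideal.span (Set.range (restrictedPartials ε f x))).comap
        (hyperplaneRestrict ε x) := by
      refine sup_le (Ideal.span_le.2 ?_) (Ideal.span_le.2 ?_)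
      · rintro _ ⟨i, rfl⟩
        exact Ideal.subset_span ⟨ε i, by simp [restrictedPartials]⟩
      · rintro _ rfl
        simp [hyperplaneRestrict_self ε hx]
    exact h hp
  · intro hp
    obtain ⟨b, hb⟩ := Ideal.mem_span_range_iff_exists_fun.1 hp
    have h1 : hyperplaneRestrict ε x
        (p - ∑ l, hyperplaneSection ε x (b l) * pderiv (ε.symm l) f) = 0 := by
      simp only [map_sub, map_sum, map_mul, hyperplaneRestrict_hyperplaneSection ε hx₀]
      exact sub_eq_zero.2 hb.symm
    have h2 := hyperplaneSection_hyperplaneRestrict_sub_mem ε hx hx₀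
      (p - ∑ l, hyperplaneSection ε x (b l) * pderiv (ε.symm l) f)
    rw [h1, map_zero, sub_zero] at h2
    rw [← sub_add_cancel p (∑ l, hyperplaneSection ε x (b l) * pderiv (ε.symm l) f)]
    exact Ideal.add_mem _ (Ideal.mem_sup_right h2) (Ideal.mem_sup_left (Ideal.sum_mem _ fun l _ =>
      Ideal.mul_mem_left _ _ (Ideal.subset_span ⟨_, rfl⟩)))

lemma isHomogeneous_restrictedPartials {f : S n} {a : ℕ} (hf : f.IsHomogeneous (a + 1)) (x : S n)
    (l : Option κ) : (restrictedPartials ε f x l).IsHomogeneous a := by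
  have h1 : (pderiv (ε.symm l) f).IsHomogeneous a := hf.pderiv
  exact isHomogeneous_hyperplaneRestrict ε x h1

variable {f : S n} {a : ℕ} (hf : f.IsHomogeneous (a + 1))
  (hB : NoCubicSyzygy (restrictedPartials ε f x))

include hx hx₀ hf hB in
lemma mem_JX_of_X_mul_mem [Nontrivial κ] {j : ℕ} (hj : j ≤ a + 1) {m : S n}
    (hm : m.IsHomogeneous j) (h : ∀ k : κ, X (ε.symm (some k)) * m ∈ JX f x) : m ∈ JX f x := by
  simp only [mem_JX_iff ε hx hx₀] at h ⊢
  refine hB.mem_span_of_X_mul_mem (fun l => isHomogeneous_restrictedPartials ε hf x l) hj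
    (isHomogeneous_hyperplaneRestrict ε x hm) fun k => ?_
  have h1 := Ideal.mul_mem_left _ (C (linCoeff ε x none)⁻¹) (h k)
  simpa [restrictVar, ← smul_eq_C_mul, smul_smul, hx₀] using h1

include hx hx₀ hf hB in
lemma socleVanishes_JX [Nontrivial κ] : SocleVanishes (JX f x) (a + 1) :=
  fun _ hj _ hm h => mem_JX_of_X_mul_mem ε hx hx₀ hf hB hj hm fun _ => h _

include hx hx₀ hf hB in
lemma tuplesDivisible_JX {u v w : κ} (huv : u ≠ v) (huw : u ≠ w) (hvw : v ≠ w) :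
    TuplesDivisible (JX f x) a := by
  have : Nontrivial κ := ⟨u, v, huv⟩
  intro j hj p hp h
  obtain ⟨b, hb, hpb⟩ := hB.exists_sub_X_mul_mem
    (fun l => isHomogeneous_restrictedPartials ε hf x l) huv huw hvw hj
    (p := fun k => hyperplaneRestrict ε x (p (ε.symm (some k))))
    (fun k => isHomogeneous_hyperplaneRestrict ε x (hp _)) fun i k => by
      have h1 := Ideal.mul_mem_left _ (C (linCoeff ε x none)⁻¹)
        ((mem_JX_iff ε hx hx₀).1 (h (ε.symm (some i)) (ε.symm (some k))))
      simpa [restrictVar, ← smul_eq_C_mul, smul_sub, smul_smul, hx₀] using h1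
  have hb' : ((linCoeff ε x none)⁻¹ • hyperplaneSection ε x b).IsHomogeneous j :=
    (homogeneousSubmodule (Fin (n + 1)) ℂ j).smul_mem _ (isHomogeneous_hyperplaneSection ε x hb)
  have hsome : ∀ k, p (ε.symm (some k)) -
      X (ε.symm (some k)) * ((linCoeff ε x none)⁻¹ • hyperplaneSection ε x b) ∈ JX f x := by
    intro k
    rw [mem_JX_iff ε hx hx₀]
    simpa [hyperplaneRestrict_hyperplaneSection ε hx₀, restrictVar, smul_smul, hx₀] using hpb k
  refine ⟨_, hb', fun i => ?_⟩
  obtain ⟨_ | k, rfl⟩ := ε.symm.surjective i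
  · refine mem_JX_of_X_mul_mem ε hx hx₀ hf hB (j := j + 1) (by omega) ((hp _).sub ?_) fun k => ?_
    · simpa [add_comm] using (isHomogeneous_X ℂ (ε.symm none)).mul hb'
    · have h1 := Ideal.add_mem _ (Ideal.mul_mem_left _ (X (ε.symm none)) (hsome k))
        (h (ε.symm (some k)) (ε.symm none))
      convert h1 using 1
      ring
  · exact hsome k

include hx hx₀ in
lemma mem_JX_of_forall_mul_mem
    (hA : ∀ m : MvPolynomial κ ℂ, m.IsHomogeneous (a + 2) →
      (∀ Q : MvPolynomial κ ℂ, Q.IsHomogeneous a →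
        Q * m ∈ Ideal.span (Set.range (restrictedPartials ε f x))) →
      m ∈ Ideal.span (Set.range (restrictedPartials ε f x)))
    {m : S n} (hm : m.IsHomogeneous (a + 2))
    (h : ∀ Q : S n, Q.IsHomogeneous a → Q * m ∈ JX f x) : m ∈ JX f x := by
  simp only [mem_JX_iff ε hx hx₀] at h ⊢
  refine hA _ (isHomogeneous_hyperplaneRestrict ε x hm) fun Q hQ => ?_
  simpa [hyperplaneRestrict_hyperplaneSection ε hx₀] using
    h _ (isHomogeneous_hyperplaneSection ε x hQ)

end HyperplaneRestriction

section SpecialPoint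

variable {n : ℕ} {κ : Type*} [Fintype κ] (ε : Fin (n + 1) ≃ Option κ)

lemma isPolyFamily_hyperplaneRestrict {Y : Type} [AddCommGroup Y] [Module ℂ Y]
    (ξ : Y →ₗ[ℂ] S n) (p : S n) : IsPolyFamily fun y => hyperplaneRestrict ε (ξ y) p := by
  have hlin : ∀ l, IsPolyFun fun y => linCoeff ε (ξ y) l := fun l =>
    IsPolyFun.linear (lcoeff ℂ (Finsupp.single (ε.symm l) 1) ∘ₗ ξ)
  induction p using MvPolynomial.induction_on with
  | C r => simpa [hyperplaneRestrict] using IsPolyFamily.const (C r)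
  | add p q hp hq => simpa only [map_add] using hp.add hq
  | mul_X p i hp =>
    obtain ⟨l, rfl⟩ := ε.symm.surjective i
    simp only [map_mul, hyperplaneRestrict_X_symm]
    refine hp.mul ?_
    cases l with
    | none => exact (IsPolyFamily.sum fun k _ => (IsPolyFamily.const (X k)).smul (hlin _)).neg
    | some k => exact (IsPolyFamily.const (X k)).smul (hlin _)

lemma isPolyFamily_restrictedPartials {d : ℕ} (l : Option κ) :
    IsPolyFamily fun y : homogeneousSubmodule (Fin (n + 1)) ℂ d ×
        homogeneousSubmodule (Fin (n + 1)) ℂ 1 => restrictedPartials ε (y.1 : S n) (y.2 : S n) l := by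
  let b := Module.finBasis ℂ (homogeneousSubmodule (Fin (n + 1)) ℂ d)
  have h : ∀ y : homogeneousSubmodule (Fin (n + 1)) ℂ d × homogeneousSubmodule (Fin (n + 1)) ℂ 1,
      restrictedPartials ε (y.1 : S n) (y.2 : S n) l =
        ∑ i, b.coord i y.1 • restrictedPartials ε (b i : S n) (y.2 : S n) l := by
    intro y
    have h1 := congrArg ((hyperplaneRestrict ε (y.2 : S n)).toLinearMap ∘ₗ
      (pderiv (ε.symm l)).toLinearMap ∘ₗ Submodule.subtype _) (b.sum_repr y.1)
    simp only [map_sum, map_smul] at h1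
    exact h1.symm
  simp only [h]
  refine IsPolyFamily.sum fun i _ => IsPolyFamily.smul
    (φ := fun y : homogeneousSubmodule (Fin (n + 1)) ℂ d ×
      homogeneousSubmodule (Fin (n + 1)) ℂ 1 => b.coord i y.1)
    (IsPolyFun.linear (b.coord i ∘ₗ LinearMap.fst ℂ _ (homogeneousSubmodule (Fin (n + 1)) ℂ 1))) ?_
  exact isPolyFamily_hyperplaneRestrict ε ((homogeneousSubmodule (Fin (n + 1)) ℂ 1).subtype ∘ₗ
    LinearMap.snd ℂ (homogeneousSubmodule (Fin (n + 1)) ℂ d) _) _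

/-- A form whose partial derivatives restrict to `g, X_k ^ a` on a coordinate hyperplane. -/
def specialForm (g : MvPolynomial κ ℂ) (a : ℕ) : S n :=
  X (ε.symm none) * rename (ε.symm ∘ some) g +
    ∑ k, (a + 1 : ℂ)⁻¹ • X (ε.symm (some k)) ^ (a + 1)

lemma isHomogeneous_specialForm {g : MvPolynomial κ ℂ} {a : ℕ} (hg : g.IsHomogeneous a) :
    (specialForm ε g a).IsHomogeneous (a + 1) := by
  refine IsHomogeneous.add ?_ (IsHomogeneous.sum _ _ _ fun k _ =>
    (homogeneousSubmodule (Fin (n + 1)) ℂ (a + 1)).smul_mem _ (isHomogeneous_X_pow _ _))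
  simpa [add_comm] using (isHomogeneous_X ℂ (ε.symm none)).mul hg.rename_isHomogeneous

omit [Fintype κ] in
lemma linCoeff_X (l m : Option κ) [DecidableEq κ] :
    linCoeff ε (X (ε.symm m)) l = if m = l then 1 else 0 := by
  simp [linCoeff, coeff_X, Finsupp.single_left_inj]

lemma restrictedPartials_specialForm (g : MvPolynomial κ ℂ) (a : ℕ) :
    restrictedPartials ε (specialForm ε g a) (X (ε.symm none)) = consPow g a := by
  classical
  have hR : ∀ l, hyperplaneRestrict ε (X (ε.symm none)) (X (ε.symm l)) =
      l.elim 0 X := by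
    intro l
    cases l <;> simp [restrictVar, linCoeff_X]
  have hr : ∀ p : MvPolynomial κ ℂ, hyperplaneRestrict ε (X (ε.symm none))
      (rename (ε.symm ∘ some) p) = p := by
    intro p
    have h : ((hyperplaneRestrict ε (X (ε.symm none))).comp (rename (ε.symm ∘ some))) =
        AlgHom.id ℂ _ := by
      ext1 k
      simp [hR, -hyperplaneRestrict_X_symm]
    exact DFunLike.congr_fun h p
  have ha : (a + 1 : ℂ) ≠ 0 := by exact_mod_cast Nat.succ_ne_zero a
  have hv : pderiv (ε.symm none) (rename (ε.symm ∘ some) g) = 0 := by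
    refine pderiv_eq_zero_of_notMem_vars fun h => ?_
    obtain ⟨k, -, hk⟩ := Finset.mem_image.1 (vars_rename _ _ h)
    simp at hk
  ext1 l
  cases l with
  | none =>
    simp [restrictedPartials, specialForm, pderiv_X, consPow, hr, hv,
      Derivation.leibniz_pow, -hyperplaneRestrict_X_symm]
  | some k =>
    have hk : ((a : MvPolynomial κ ℂ) + 1) * X k ^ a = (a + 1 : ℂ) • X k ^ a := by
      simp [smul_eq_C_mul]
    simp [restrictedPartials, specialForm, pderiv_X, Pi.single_apply, consPow, hR,
      Derivation.leibniz_pow, -hyperplaneRestrict_X_symm, hk, ha, smul_smul]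

end SpecialPoint

/-- For generic `(f, x)` the ideal `J_f + (x)` satisfies the vanishing conditions under which
module morphisms are multiplications. -/
theorem genericallyHolds_vanishing {n c : ℕ} {τ σ : Type*} [Fintype τ] [Fintype σ]
    (ε : Fin (n + 1) ≃ Option (τ ⊕ σ)) (hc : 3 ≤ c) (hτ : c + 4 ≤ Fintype.card τ * c)
    (hσ : 3 * c + 7 ≤ Fintype.card σ * c) :
    GenericallyHolds fun y : homogeneousSubmodule (Fin (n + 1)) ℂ (c + 2) ×
        homogeneousSubmodule (Fin (n + 1)) ℂ 1 =>
      SocleVanishes (JX (y.1 : S n) (y.2 : S n)) (c + 2) ∧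
      TuplesDivisible (JX (y.1 : S n) (y.2 : S n)) (c + 1) ∧
      ∀ m : S n, m.IsHomogeneous (c + 3) →
        (∀ Q : S n, Q.IsHomogeneous (c + 1) → Q * m ∈ JX (y.1 : S n) (y.2 : S n)) →
        m ∈ JX (y.1 : S n) (y.2 : S n) := by
  classical
  have hcard : 2 < Fintype.card σ := by
    by_contra! h
    have := Nat.mul_le_mul_right c h
    omega
  obtain ⟨u, v, w, huv, huw, hvw⟩ := Fintype.two_lt_card_iff.1 hcard
  have : Nonempty σ := ⟨u⟩
  have : Nontrivial (τ ⊕ σ) := ⟨Sum.inr u, Sum.inr v, by simpa using huv⟩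
  let Y := homogeneousSubmodule (Fin (n + 1)) ℂ (c + 2) × homogeneousSubmodule (Fin (n + 1)) ℂ 1
  let g := sumPow τ σ (c + 1)
  let F : Y → Option (τ ⊕ σ) → MvPolynomial (τ ⊕ σ) ℂ := fun y =>
    restrictedPartials ε (y.1 : S n) (y.2 : S n)
  let y₀ : Y := (⟨specialForm ε g (c + 1), isHomogeneous_specialForm ε (isHomogeneous_sumPow _)⟩,
    ⟨X (ε.symm none), isHomogeneous_X ℂ _⟩)
  have hF₀ : F y₀ = consPow g (c + 1) := restrictedPartials_specialForm ε g (c + 1)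
  have hF : ∀ y l, (F y l).IsHomogeneous (c + 1) := fun y l =>
    isHomogeneous_restrictedPartials ε y.1.2 _ l
  have hF' : ∀ l, IsPolyFamily fun y => F y l := isPolyFamily_restrictedPartials ε
  let b := Module.finBasis ℂ (homogeneousSubmodule (τ ⊕ σ) ℂ (c + 1))
  obtain ⟨φ, hφ, hφ₀, hφB⟩ := exists_isPolyFun_syzygy_eq_zero hF hF' 3 y₀ <| by
    intro q hq h
    rw [hF₀] at h
    exact eq_zero_of_syzygy_special (by omega) hc hq h
  obtain ⟨ψ, hψ, hψ₀, hψA⟩ := exists_isPolyFun_colon hF hF' 2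
    (fun i => (b i : MvPolynomial (τ ⊕ σ) ℂ)) (fun i => (b i).2) y₀ (by
      intro q hq h
      rw [hF₀] at h ⊢
      exact exists_isHomogeneous_koszul_special (by omega) hq h) (by
      intro m hm h
      rw [hF₀] at h ⊢
      refine mem_span_of_forall_mul_mem_special hτ (by convert hm using 1; omega) fun Q hQ => ?_
      have hQ' := congrArg Subtype.val (b.sum_repr ⟨Q, hQ⟩)
      rw [← show _ = Q from hQ']
      simp only [AddSubmonoidClass.coe_finsetSum, Submodule.coe_smul, Finset.sum_mul,
        smul_eq_C_mul, mul_assoc]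
      exact Ideal.sum_mem _ fun i _ => Ideal.mul_mem_left _ _ (h i))
  refine ⟨fun y => linCoeff ε (y.2 : S n) none * (φ y * ψ y), ?_, ⟨y₀, ?_⟩, fun y hy => ?_⟩
  · have h1 : IsPolyFun fun y : Y => linCoeff ε (y.2 : S n) none :=
      IsPolyFun.linear (lcoeff ℂ (Finsupp.single (ε.symm none) 1) ∘ₗ
        (homogeneousSubmodule (Fin (n + 1)) ℂ 1).subtype ∘ₗ
          LinearMap.snd ℂ (homogeneousSubmodule (Fin (n + 1)) ℂ (c + 2)) _)
    exact h1.mul (hφ.mul hψ)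
  · have h1 : linCoeff ε (y₀.2 : S n) none = 1 := by simp [y₀, linCoeff_X]
    simp [h1, hφ₀, hψ₀]
  · obtain ⟨hx₀, hφy, hψy⟩ : linCoeff ε (y.2 : S n) none ≠ 0 ∧ φ y ≠ 0 ∧ ψ y ≠ 0 := by
      simpa [not_or] using hy
    have hB : NoCubicSyzygy (restrictedPartials ε (y.1 : S n) (y.2 : S n)) := hφB y hφy
    refine ⟨socleVanishes_JX ε y.2.2 hx₀ y.1.2 hB,
      tuplesDivisible_JX ε y.2.2 hx₀ y.1.2 hB (Sum.inr_injective.ne huv)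
        (Sum.inr_injective.ne huw) (Sum.inr_injective.ne hvw), fun m hm h => ?_⟩
    refine mem_JX_of_forall_mul_mem ε y.2.2 hx₀ (a := c + 1) (fun m hm h => ?_) hm h
    exact hψA y hψy m (by rwa [add_comm]) fun i => h _ (b i).2

/-- The degree conditions allow splitting the remaining variables into two groups. -/
lemma exists_equiv_option_sum {n c : ℕ} (h : (3 ≤ c ∧ 9 ≤ n) ∨ (4 ≤ c ∧ 7 ≤ n)) :
    ∃ s t : ℕ, Nonempty (Fin (n + 1) ≃ Option (Fin t ⊕ Fin s)) ∧ c + 4 ≤ t * c ∧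
      3 * c + 7 ≤ s * c := by
  have heq : ∀ s t : ℕ, t + s = n → Nonempty (Fin (n + 1) ≃ Option (Fin t ⊕ Fin s)) := by
    rintro s t rfl
    exact Fintype.card_eq.1 (by simp)
  rcases le_or_gt 4 c with hc | hc
  · refine ⟨5, n - 5, heq _ _ (by omega), ?_, by omega⟩
    have := Nat.mul_le_mul_right c (show 2 ≤ n - 5 by omega)
    omega
  · refine ⟨6, n - 6, heq _ _ (by omega), ?_, by omega⟩
    have := Nat.mul_le_mul_right c (show 3 ≤ n - 6 by omega)
    omega

/-- Lemma on morphisms of `R_f^d`-modules.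
For `(d ≥ 5, n ≥ 9)` or `(d ≥ 6, n ≥ 7)` and generic `(f, x)`: every `R_f^d`-module
morphism `h : R_f^{d-1} → R_f^d / x·R_f^{d-1}` is induced by multiplication by a linear
form `y ∈ S¹`.  Here `h` is modelled as a linear map from `S^{d-1}` killing `J_f^{d-1}`
with values in the degree-`d` piece of `S/(J_f + (x))`, and the module-morphism condition
asks for `h' : R_f^{2d-1} → R_f^{2d}/x·R_f^{2d-1}` with `h'(A·B) = A·h(B)`. -/
theorem module_morphism_is_multiplication (n d : ℕ)
    (hdn : (5 ≤ d ∧ 9 ≤ n) ∨ (6 ≤ d ∧ 7 ≤ n)) :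
    GenericallyHolds (fun fx : (MvPolynomial.homogeneousSubmodule (Fin (n + 1)) ℂ d) ×
        (MvPolynomial.homogeneousSubmodule (Fin (n + 1)) ℂ 1) =>
      ∀ h : (MvPolynomial.homogeneousSubmodule (Fin (n + 1)) ℂ (d - 1)) →ₗ[ℂ]
          (S n ⧸ JX (fx.1 : S n) (fx.2 : S n)),
        (∀ B : MvPolynomial.homogeneousSubmodule (Fin (n + 1)) ℂ (d - 1),
          (B : S n) ∈ jacobianIdeal (fx.1 : S n) → h B = 0) →
        (∀ B, h B ∈ quotPiece (JX (fx.1 : S n) (fx.2 : S n)) d) →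
        (∃ h' : (MvPolynomial.homogeneousSubmodule (Fin (n + 1)) ℂ (2 * d - 1)) →ₗ[ℂ]
            (S n ⧸ JX (fx.1 : S n) (fx.2 : S n)),
          (∀ C : MvPolynomial.homogeneousSubmodule (Fin (n + 1)) ℂ (2 * d - 1),
            (C : S n) ∈ jacobianIdeal (fx.1 : S n) → h' C = 0) ∧
          (∀ C, h' C ∈ quotPiece (JX (fx.1 : S n) (fx.2 : S n)) (2 * d)) ∧
          (∀ (A : S n) (hA : A.IsHomogeneous d)
              (B : MvPolynomial.homogeneousSubmodule (Fin (n + 1)) ℂ (d - 1)),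
            h' ⟨A * (B : S n), by
                rw [MvPolynomial.mem_homogeneousSubmodule,
                  show 2 * d - 1 = d + (d - 1) from by omega]
                exact hA.mul B.2⟩ =
              Ideal.Quotient.mk (JX (fx.1 : S n) (fx.2 : S n)) A * h B)) →
        ∃ y : S n, y.IsHomogeneous 1 ∧
          ∀ B : MvPolynomial.homogeneousSubmodule (Fin (n + 1)) ℂ (d - 1),
            h B = Ideal.Quotient.mk (JX (fx.1 : S n) (fx.2 : S n)) (y * (B : S n))) := by
  obtain ⟨c, rfl⟩ : ∃ c, d = c + 2 := ⟨d - 2, by omega⟩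
  obtain ⟨s, t, ⟨ε⟩, ht, hs⟩ := exists_equiv_option_sum (n := n) (c := c) (by omega)
  obtain ⟨φ, hφ, hφ₀, hφh⟩ := genericallyHolds_vanishing (c := c) ε (by omega) (by simpa using ht)
    (by simpa using hs)
  refine ⟨φ, hφ, hφ₀, fun y hy h _ hh h' => ?_⟩
  obtain ⟨h', -, -, hh'⟩ := h'
  obtain ⟨hS, hT, hA⟩ := hφh y hy
  obtain ⟨g, hg⟩ := LinearMap.exists_extend h'
  refine exists_linear_form_of_module_morphism (a := c + 1) hS hT hA h hh g fun A hA B => ?_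
  rw [← hh' A hA B, ← hg]
  rfl

end
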